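/- Fix integers d ≥ 1, H ≥ 1, p ≥ 1, a gradient threshold θ > 0, a degree bound Δ ≥ 1, and a fixed step size η ≥ 0. Consider gradient descent with the initial point x ∈ ℝ^d as the hyperparameter: iterates x_1 = x, x_{i+1} = x_i − η∇f(x_i), with cost ℓ(x, f) equal to the smallest i ∈ {1,…,H} with ‖∇f(x_i)‖ < θ if one exists, and H otherwise. Let Π be a set of instances f : ℝ^d → ℝ that are piecewise polynomial with at most p polynomial boundaries and degree at most Δ, such that no gradient-descent iterate ever lies on a boundary of f. Then for every ε > 0, every δ ∈ (0,1) and every probability distribution D over Π, (ε, δ)-uniform convergence of the class {f ↦ ℓ(x, f) : x ∈ ℝ^d} holds with m samples, where m = O((H²/ε²)(dH·log(2pdΔ) + log(1/δ))). -/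

import Mathlib

open MeasureTheory

/-- Gradient-descent iterates: `gdIter f x η i` is the `(i+1)`-st iterate `x_{i+1}`,
so `gdIter f x η 0 = x₁ = x` and `x_{i+1} = x_i - η ∇f(x_i)`. -/
noncomputable def gdIter {d : ℕ} (f : EuclideanSpace ℝ (Fin d) → ℝ)
    (x : EuclideanSpace ℝ (Fin d)) (η : ℝ) : ℕ → EuclideanSpace ℝ (Fin d)
  | 0 => x
  | i + 1 => gdIter f x η i - η • gradient f (gdIter f x η i)

/-- Gradient-descent cost: the smallest `i ∈ {1,…,H}` with `‖∇f(x_i)‖ < θ` if it exists,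
and `H` otherwise. -/
noncomputable def gdCost {d : ℕ} (H : ℕ) (θ : ℝ) (f : EuclideanSpace ℝ (Fin d) → ℝ)
    (x : EuclideanSpace ℝ (Fin d)) (η : ℝ) : ℕ :=
  sInf ({i | 1 ≤ i ∧ i ≤ H ∧ ‖gradient f (gdIter f x η (i - 1))‖ < θ} ∪ {H})

/-- `f : ℝ^d → ℝ` is piecewise polynomial with boundary polynomials `g` (each nonzero, of
degree at most `Δ`): on each connected component of the complement of the zero sets of the
boundaries, `f` agrees with some polynomial of degree at most `Δ`. -/
def IsPWPolyWith {d : ℕ} (p Δ : ℕ) (f : EuclideanSpace ℝ (Fin d) → ℝ)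
    (g : Fin p → MvPolynomial (Fin d) ℝ) : Prop :=
  (∀ k, g k ≠ 0 ∧ (g k).totalDegree ≤ Δ) ∧
  ∀ y : EuclideanSpace ℝ (Fin d),
    (∀ k, MvPolynomial.eval (fun j => y j) (g k) ≠ 0) →
    ∃ q : MvPolynomial (Fin d) ℝ, q.totalDegree ≤ Δ ∧
      ∀ w ∈ connectedComponentIn
          {w : EuclideanSpace ℝ (Fin d) | ∀ k, MvPolynomial.eval (fun j => w j) (g k) ≠ 0} y,
        f w = MvPolynomial.eval (fun j => w j) q

namespace GDPW

open MvPolynomial in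
theorem hasFDerivAt_eval {d : ℕ} (p : MvPolynomial (Fin d) ℝ) (y : Fin d → ℝ) :
    HasFDerivAt (fun y : Fin d → ℝ => eval y p)
      (∑ j, eval y (pderiv j p) • (ContinuousLinearMap.proj j : (Fin d → ℝ) →L[ℝ] ℝ)) y := by
  induction p using MvPolynomial.induction_on with
  | C a => simpa using hasFDerivAt_const a y
  | add p q hp hq =>
    simp only [map_add, add_smul, Finset.sum_add_distrib]
    exact hp.add hq
  | mul_X p i hp =>
    have h1 : HasFDerivAt (fun y : Fin d → ℝ => y i)
      (ContinuousLinearMap.proj i : (Fin d → ℝ) →L[ℝ] ℝ) y :=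
      (ContinuousLinearMap.proj i : (Fin d → ℝ) →L[ℝ] ℝ).hasFDerivAt
    have h2 := hp.mul h1
    simp only [map_mul, eval_X]
    refine h2.congr_fderiv ?_
    ext v
    simp only [Derivation.leibniz, pderiv_X, smul_eq_mul, map_add, map_mul, eval_X]
    simp [Finset.sum_add_distrib, add_mul, Finset.mul_sum, Pi.single_apply, apply_ite,
      mul_assoc]

theorem totalDegree_pderiv_le {d : ℕ} (j : Fin d) (p : MvPolynomial (Fin d) ℝ) :
    (MvPolynomial.pderiv j p).totalDegree ≤ p.totalDegree := by
  conv_lhs => rw [p.as_sum]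
  rw [map_sum]
  refine MvPolynomial.totalDegree_finsetSum_le fun s hs => ?_
  rw [MvPolynomial.pderiv_monomial]
  refine (MvPolynomial.totalDegree_monomial_le _ _).trans ?_
  refine le_trans ?_ (MvPolynomial.le_totalDegree hs)
  have : s - Finsupp.single j 1 ≤ s := tsub_le_self
  exact Finsupp.sum_le_sum_index this (fun i _ => monotone_id) (by simp)

open MvPolynomial in
/-- Interpolation: evaluation of polynomials at finitely many points is onto. -/
theorem exists_interp {d : ℕ} (V : Finset (Fin d → ℝ)) (v : Fin d → ℝ) :
    ∃ p : MvPolynomial (Fin d) ℝ, ∀ w ∈ V, eval w p = if w = v then 1 else 0 := by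
  classical
  have h : ∀ w : Fin d → ℝ, ∃ p : MvPolynomial (Fin d) ℝ, w ≠ v → eval v p = 1 ∧ eval w p = 0 := by
    intro w
    by_cases hw : w = v
    · exact ⟨0, fun h => (h hw).elim⟩
    · obtain ⟨j, hj⟩ := Function.ne_iff.mp hw
      refine ⟨C ((v j - w j)⁻¹) * (X j - C (w j)), fun _ => ?_⟩
      have : v j - w j ≠ 0 := sub_ne_zero.mpr (Ne.symm hj)
      constructor
      · simp [this]
      · simp
  choose P hP using h
  refine ⟨∏ w ∈ V.erase v, P w, fun w hw => ?_⟩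
  rw [map_prod]
  split_ifs with h
  · subst h
    exact Finset.prod_eq_one fun u hu => (hP u (Finset.ne_of_mem_erase hu)).1
  · exact Finset.prod_eq_zero (Finset.mem_erase.mpr ⟨h, hw⟩) (hP w h).2

open MvPolynomial in
theorem zeros_card_le {d e : ℕ} (Q : Fin d → MvPolynomial (Fin d) ℝ)
    (hQ : ∀ j, (Q j).totalDegree < e) (V : Finset (Fin d → ℝ))
    (hV : ∀ v ∈ V, ∀ j, v j ^ e = eval v (Q j)) : V.card ≤ e ^ d := by
  classical
  let ev : MvPolynomial (Fin d) ℝ →ₗ[ℝ] (V → ℝ) :=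
    { toFun := fun p v => eval v.1 p
      map_add' := by intros; ext; simp
      map_smul' := by intros; ext; simp }
  let mon : (Fin d → Fin e) → (V → ℝ) := fun a v => ∏ j, v.1 j ^ (a j : ℕ)
  let S := Submodule.span ℝ (Set.range mon)
  have key : ∀ n : ℕ, ∀ p : MvPolynomial (Fin d) ℝ, p.totalDegree ≤ n → ev p ∈ S := by
    intro n
    induction n using Nat.strong_induction_on with
    | _ n ih =>
      intro p hp
      rw [p.as_sum, map_sum]
      refine Submodule.sum_mem _ fun s hs => ?_
      have hsn : (s.sum fun _ k => k) ≤ n := (MvPolynomial.le_totalDegree hs).trans hp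
      have hmon : monomial s (coeff s p) = (coeff s p) • monomial s (1 : ℝ) := by
        rw [smul_monomial, smul_eq_mul, mul_one]
      rw [hmon, map_smul]
      refine Submodule.smul_mem _ _ ?_
      by_cases hall : ∀ j, s j < e
      · refine Submodule.subset_span ⟨fun j => ⟨s j, hall j⟩, ?_⟩
        ext v
        simp [ev, mon, eval_monomial, Finsupp.prod_fintype]
      · push Not at hall
        obtain ⟨j, hj⟩ := hall
        have hsplit : s = (s - Finsupp.single j e) + Finsupp.single j e := by
          rw [tsub_add_cancel_of_le]
          simpa using hj
        set r := s - Finsupp.single j e with hr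
        have hev : ev (monomial s 1) = ev (monomial r 1 * Q j) := by
          ext v
          have h1 : (monomial s (1:ℝ)) = monomial r 1 * X j ^ e := by
            rw [X_pow_eq_monomial, monomial_mul, ← hsplit, mul_one]
          rw [h1]
          simp only [ev, LinearMap.coe_mk, AddHom.coe_mk, map_mul, map_pow, eval_X]
          rw [hV v.1 v.2 j]
        rw [hev]
        have hdeg : (monomial r (1:ℝ) * Q j).totalDegree < n := by
          have h2 : (s.sum fun _ k => k) = (r.sum fun _ k => k) + e := by
            conv_lhs => rw [hsplit]
            rw [Finsupp.sum_add_index'] <;> simp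
          have h3 := totalDegree_monomial_le r (1:ℝ)
          have h4 := totalDegree_mul (monomial r (1:ℝ)) (Q j)
          have h5 := hQ j
          have h3' : (monomial r (1:ℝ)).totalDegree ≤ r.sum fun _ k => k := h3
          omega
        exact ih _ hdeg _ le_rfl
  have htop : S = ⊤ := by
    rw [eq_top_iff]
    rintro f -
    choose P hP using exists_interp V
    have : f = ev (∑ v : V, f v • P v.1) := by
      ext w
      have hsum : ev (∑ v : V, f v • P v.1) w = ∑ v : V, f v * eval w.1 (P v.1) := by
        simp [ev, map_sum, smul_eval, Finset.sum_apply]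
      rw [hsum, Finset.sum_eq_single w]
      · rw [hP _ _ w.2]; simp
      · intro b _ hb
        rw [hP _ _ w.2, if_neg (fun h => hb (Subtype.ext h.symm))]; simp
      · simp
    rw [this]
    exact key _ _ le_rfl
  have h1 : Module.finrank ℝ S ≤ Fintype.card (Fin d → Fin e) := finrank_range_le_card mon
  rw [htop, finrank_top, Module.finrank_fintype_fun_eq_card] at h1
  simpa using h1

open MvPolynomial in
/-- Number of sign patterns. -/
theorem sign_patterns_card_le {d D : ℕ} {ι : Type*} [Fintype ι]
    (F : ι → MvPolynomial (Fin d) ℝ) (hF : ∀ i, (F i).totalDegree ≤ D)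
    (X : Finset (Fin d → ℝ))
    (hX : ∀ x ∈ X, ∀ y ∈ X, (∀ i, 0 ≤ eval x (F i) ↔ 0 ≤ eval y (F i)) → x = y) :
    X.card ≤ (2 * (Fintype.card ι * D) + 1) ^ d := by
  classical
  -- shift
  obtain ⟨τ, hτ0, hτ⟩ : ∃ τ : ℝ, 0 < τ ∧ ∀ x ∈ X, ∀ i, eval x (F i) < 0 → eval x (F i) + τ < 0 := by
    have : ∀ᶠ τ : ℝ in nhdsWithin 0 (Set.Ioi 0),
        ∀ x ∈ X, ∀ i, eval x (F i) < 0 → eval x (F i) + τ < 0 := by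
      rw [Filter.eventually_all_finset]
      intro x _
      rw [Filter.eventually_all]
      intro i
      by_cases h : eval x (F i) < 0
      · have h2 : Filter.Tendsto (fun τ : ℝ => eval x (F i) + τ) (nhdsWithin 0 (Set.Ioi 0))
            (nhds (eval x (F i) + 0)) :=
          (Continuous.tendsto (by fun_prop) _).mono_left nhdsWithin_le_nhds
        rw [add_zero] at h2
        filter_upwards [h2.eventually_lt_const h] with t ht _ using ht
      · exact Filter.Eventually.of_forall fun _ h' => (h h').elim
    obtain ⟨τ, h1, h2⟩ := (this.and self_mem_nhdsWithin).exists
    exact ⟨τ, h2, h1⟩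
  let Fs : ι → MvPolynomial (Fin d) ℝ := fun i => F i + C τ
  have hFs : ∀ i, (Fs i).totalDegree ≤ D := fun i =>
    (totalDegree_add _ _).trans (by simp [hF i])
  have hpos : ∀ x ∈ X, ∀ i, (0 ≤ eval x (F i) ↔ 0 < eval x (Fs i)) ∧ eval x (Fs i) ≠ 0 := by
    intro x hx i
    simp only [Fs, map_add, eval_C]
    rcases lt_or_ge (eval x (F i)) 0 with h | h
    · have := hτ x hx i h
      exact ⟨⟨fun h' => by linarith, fun h' => by linarith⟩, by linarith⟩
    · exact ⟨⟨fun h' => by linarith, fun h' => h⟩, by linarith⟩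
  set k := Fintype.card ι * D + 1 with hk
  let P : MvPolynomial (Fin d) ℝ := (∏ i, Fs i) ^ 2
  have hPdeg : P.totalDegree ≤ 2 * (Fintype.card ι * D) := by
    refine (totalDegree_pow _ _).trans ?_
    refine Nat.mul_le_mul_left _ ((totalDegree_finsetProd _ _).trans ?_)
    refine (Finset.sum_le_card_nsmul _ _ D fun i _ => hFs i).trans ?_
    simp
  have hPev : ∀ x, eval x P = (∏ i, eval x (Fs i)) ^ 2 := by intro x; simp [P]
  have hPpos : ∀ x ∈ X, 0 < eval x P := by
    intro x hx
    rw [hPev]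
    have : ∏ i, eval x (Fs i) ≠ 0 := Finset.prod_ne_zero_iff.mpr fun i _ => (hpos x hx i).2
    positivity
  let Nn : (Fin d → ℝ) → ℝ := fun x => ∑ j, x j ^ (2 * k)
  have hNn : ∀ x, 0 ≤ Nn x := fun x => Finset.sum_nonneg fun j _ => by
    rw [pow_mul]; positivity
  obtain ⟨t, ht0, ht⟩ : ∃ t : ℝ, 0 < t ∧ ∀ x ∈ X, 0 < eval x P - t * Nn x := by
    have : ∀ᶠ t : ℝ in nhdsWithin 0 (Set.Ioi 0), ∀ x ∈ X, 0 < eval x P - t * Nn x := by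
      rw [Filter.eventually_all_finset]
      intro x hx
      have h2 : Filter.Tendsto (fun t : ℝ => eval x P - t * Nn x) (nhdsWithin 0 (Set.Ioi 0))
            (nhds (eval x P - 0 * Nn x)) :=
          (Continuous.tendsto (by fun_prop) _).mono_left nhdsWithin_le_nhds
      rw [zero_mul, sub_zero] at h2
      exact h2.eventually_const_lt (hPpos x hx)
    obtain ⟨τ, h1, h2⟩ := (this.and self_mem_nhdsWithin).exists
    exact ⟨τ, h2, h1⟩
  -- growth at infinity
  have hinf : ∃ R : ℝ, ∀ x : Fin d → ℝ, R < ‖x‖ → eval x P - t * Nn x ≤ 0 := by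
    let c : ℝ := ∑ s ∈ P.support, |coeff s P|
    have hb : ∀ x : Fin d → ℝ, 1 ≤ ‖x‖ → eval x P ≤ c * ‖x‖ ^ (2 * (Fintype.card ι * D)) := by
      intro x hx
      rw [eval_eq', Finset.sum_mul]
      refine Finset.sum_le_sum fun s hs => ?_
      refine (le_abs_self _).trans ?_
      rw [abs_mul]
      refine mul_le_mul_of_nonneg_left ?_ (abs_nonneg _)
      rw [Finset.abs_prod]
      calc ∏ i, |x i ^ s i| ≤ ∏ i, ‖x‖ ^ s i := by
            refine Finset.prod_le_prod (fun i _ => abs_nonneg _) fun i _ => ?_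
            rw [abs_pow]
            exact pow_le_pow_left₀ (abs_nonneg _) (norm_le_pi_norm x i) _
        _ = ‖x‖ ^ (∑ i, s i) := by rw [Finset.prod_pow_eq_pow_sum]
        _ ≤ _ := by
          refine pow_le_pow_right₀ hx ?_
          have := (MvPolynomial.le_totalDegree hs).trans hPdeg
          rwa [Finsupp.sum_fintype _ _ (by simp)] at this
    refine ⟨max 1 (c / t), fun x hx => ?_⟩
    have hx1 : 1 < ‖x‖ := lt_of_le_of_lt (le_max_left _ _) hx
    have hx2 : c / t < ‖x‖ := lt_of_le_of_lt (le_max_right _ _) hx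
    have hN : ‖x‖ ^ (2 * k) ≤ Nn x := by
      have hd : Nonempty (Fin d) := by
        by_contra hne
        rw [not_nonempty_iff] at hne
        have : x = 0 := Subsingleton.elim _ _
        rw [this, norm_zero] at hx1
        linarith
      obtain ⟨j, hj⟩ : ∃ j, ‖x‖ = ‖x j‖ := by
        obtain ⟨j, -, hj⟩ := Finset.exists_mem_eq_sup' (s := Finset.univ) Finset.univ_nonempty
          (fun j => ‖x j‖₊)
        refine ⟨j, ?_⟩
        rw [Pi.norm_def, ← Finset.sup'_eq_sup Finset.univ_nonempty, hj, coe_nnnorm]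
      rw [hj, Real.norm_eq_abs, pow_mul, sq_abs, ← pow_mul]
      exact Finset.single_le_sum (f := fun j => x j ^ (2*k))
        (fun i _ => by rw [pow_mul]; positivity) (Finset.mem_univ j)
    have h1 := hb x hx1.le
    have h2 : c * ‖x‖ ^ (2 * (Fintype.card ι * D)) ≤ t * ‖x‖ ^ (2 * k) := by
      have : 2 * k = 2 * (Fintype.card ι * D) + 1 + 1 := by omega
      rw [this, pow_succ, pow_succ]
      have h3 : c < ‖x‖ * t := by rwa [div_lt_iff₀ ht0] at hx2
      have h4 : 0 < ‖x‖ ^ (2 * (Fintype.card ι * D)) := by positivity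
      have h5 : ‖x‖ * t ≤ t * (‖x‖ * ‖x‖) := by
        rw [mul_comm]
        exact mul_le_mul_of_nonneg_left (by nlinarith) ht0.le
      nlinarith
    have h3 := mul_le_mul_of_nonneg_left hN ht0.le
    linarith
  obtain ⟨R, hR⟩ := hinf
  let G : (Fin d → ℝ) → ℝ := fun x => eval x P - t * Nn x
  have hGc : Continuous G := by
    have : Continuous fun x : Fin d → ℝ => eval x P := MvPolynomial.continuous_eval P
    have : Continuous Nn := by fun_prop
    fun_prop
  have hFc : ∀ i, Continuous fun x : Fin d → ℝ => eval x (Fs i) :=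
    fun i => MvPolynomial.continuous_eval _
  -- critical point
  have hcrit : ∀ x ∈ X, ∃ y : Fin d → ℝ, (∀ i, 0 < eval x (Fs i) * eval y (Fs i)) ∧
      ∀ j, y j ^ (2 * (Fintype.card ι * D) + 1) = eval y (C ((t * (2 * k : ℕ))⁻¹) * pderiv j P) := by
    intro x hx
    let K : Set (Fin d → ℝ) := {y | ∀ i, 0 ≤ eval x (Fs i) * eval y (Fs i)}
    have hKc : IsClosed K := by
      simp only [K, Set.ofPred_forall]
      exact isClosed_iInter fun i => isClosed_le continuous_const (continuous_const.mul (hFc i))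
    have hxK : x ∈ K := fun i => mul_self_nonneg _
    have hxR : x ∈ Metric.closedBall (0 : Fin d → ℝ) R := by
      rw [mem_closedBall_zero_iff]
      by_contra h
      have := hR x (not_le.mp h)
      have := ht x hx
      linarith
    obtain ⟨y, hyK, hy⟩ := ((isCompact_closedBall (0 : Fin d → ℝ) R).inter_right hKc).exists_isMaxOn
      ⟨x, hxR, hxK⟩ hGc.continuousOn
    have hGy : 0 < G y := lt_of_lt_of_le (ht x hx) (hy ⟨hxR, hxK⟩)
    have hPy : 0 < eval y P := by
      have := mul_nonneg ht0.le (hNn y)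
      simp only [G] at hGy
      linarith
    have hy0 : ∀ i, 0 < eval x (Fs i) * eval y (Fs i) := by
      intro i
      refine lt_of_le_of_ne (hyK.2 i) (Ne.symm (mul_ne_zero (hpos x hx i).2 ?_))
      rw [hPev] at hPy
      have : ∏ i, eval y (Fs i) ≠ 0 := fun h => by rw [h] at hPy; norm_num at hPy
      exact Finset.prod_ne_zero_iff.mp this i (Finset.mem_univ i)
    refine ⟨y, hy0, ?_⟩
    have hloc : IsLocalMax G y := by
      have hev : ∀ᶠ w in nhds y, ∀ i, 0 < eval x (Fs i) * eval w (Fs i) := by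
        rw [Filter.eventually_all]
        intro i
        exact (continuous_const.mul (hFc i)).continuousAt.eventually_const_lt (hy0 i)
      filter_upwards [hev] with w hw
      by_cases hwR : ‖w‖ ≤ R
      · exact hy ⟨mem_closedBall_zero_iff.mpr hwR, fun i => (hw i).le⟩
      · exact (hR w (not_le.mp hwR)).trans hGy.le
    let Gp : MvPolynomial (Fin d) ℝ := P - C t * ∑ j, MvPolynomial.X j ^ (2 * k)
    have hGp : G = fun x => eval x Gp := by
      ext w; simp [G, Gp, Nn, map_sum]
    rw [hGp] at hloc
    have h0 := hloc.hasFDerivAt_eq_zero (hasFDerivAt_eval Gp y)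
    intro j
    have h1 := congrArg (fun l : (Fin d → ℝ) →L[ℝ] ℝ => l (Pi.single j 1)) h0
    have h2 : eval y (pderiv j Gp) = 0 := by
      simpa [Pi.single_apply] using h1
    have h3 : pderiv j Gp = pderiv j P - C t * (C ((2 * k : ℕ) : ℝ) * MvPolynomial.X j ^ (2 * k - 1)) := by
      simp only [Gp, map_sub, map_sum, Derivation.leibniz, Derivation.leibniz_pow, pderiv_C, pderiv_X]
      simp [Pi.single_apply, map_ofNat]
    rw [h3] at h2
    have hkk : 2 * k - 1 = 2 * (Fintype.card ι * D) + 1 := by omega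
    rw [hkk] at h2
    simp only [map_sub, map_mul, eval_C, map_pow, eval_X] at h2 ⊢
    have hne : t * ((2 * k : ℕ) : ℝ) ≠ 0 := by
      have : (0:ℝ) < ((2 * k : ℕ) : ℝ) := by exact_mod_cast (by omega : 0 < 2 * k)
      positivity
    rw [← mul_assoc, sub_eq_zero] at h2
    rw [h2, inv_mul_cancel_left₀ hne]
  choose! Y hY1 hY2 using hcrit
  have hinj : Set.InjOn Y X := by
    intro x hx x' hx' h
    refine hX x hx x' hx' fun i => ?_
    rw [(hpos x hx i).1, (hpos x' hx' i).1]
    have h1 := hY1 x hx i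
    have h2 := hY1 x' hx' i
    rw [← h] at h2
    rcases lt_or_ge 0 (eval (Y x) (Fs i)) with h3 | h3
    · exact ⟨fun _ => pos_of_mul_pos_left h2 h3.le, fun _ => pos_of_mul_pos_left h1 h3.le⟩
    · exact ⟨fun h' => by nlinarith, fun h' => by nlinarith⟩
  rw [← Finset.card_image_of_injOn hinj]
  refine zeros_card_le (fun j => C ((t * (2 * k : ℕ))⁻¹) * pderiv j P) (fun j => ?_) _ ?_
  · have := totalDegree_mul (C ((t * (2 * k : ℕ))⁻¹)) (pderiv j P)
    rw [totalDegree_C] at this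
    have := totalDegree_pderiv_le j P
    omega
  · intro v hv j
    obtain ⟨x, hx, rfl⟩ := Finset.mem_image.mp hv
    exact hY2 x hx j

end GDPW

namespace GDPW

theorem packing {ι : Type*} [Fintype ι] [DecidableEq ι] (T : Finset (ι → Bool)) {r B : ℝ} {d : ℕ}
    (hr : 0 < r) (hr1 : r ≤ 1) (hB : 1 ≤ B) (hd : 1 ≤ d)
    (hsep : ∀ a ∈ T, ∀ b ∈ T, a ≠ b →
      r * Fintype.card ι < ((Finset.univ.filter fun i => a i ≠ b i).card : ℝ))
    (hg : ∀ k : ℕ, 1 ≤ k → ∀ ψ : Fin k → ι,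
      ((T.image fun a => a ∘ ψ).card : ℝ) ≤ (B * k) ^ d) :
    Real.log T.card ≤ 2 * d * Real.log (6 * B * d / r) := by
  have hd' : (1:ℝ) ≤ d := by exact_mod_cast hd
  have hbig : 6 ≤ 6 * B * d / r := by
    rw [le_div_iff₀ hr]
    nlinarith [mul_le_mul hB hd' zero_le_one (by linarith)]
  have hlog6 : 1 ≤ Real.log (6 * B * d / r) := by
    rw [Real.le_log_iff_exp_le (by linarith)]
    have := Real.exp_one_lt_d9
    linarith
  rcases le_or_gt (Real.log T.card) 1 with hL | hL
  · nlinarith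
  set L := Real.log T.card with hLdef
  have hTpos : 0 < (T.card : ℝ) := by
    rcases Nat.eq_zero_or_pos T.card with h | h
    · rw [hLdef, h] at hL; norm_num at hL
    · exact_mod_cast h
  have hM : (T.card : ℝ) = Real.exp L := (Real.exp_log hTpos).symm
  set k := ⌊2 * L / r⌋₊ + 1 with hk
  have hk1 : 2 * L / r < k := by
    have := Nat.lt_floor_add_one (2 * L / r)
    rw [hk]; push_cast; exact this
  have hk2 : (k : ℝ) ≤ 3 * L / r := by
    have h1 := Nat.floor_le (show 0 ≤ 2 * L / r by positivity)
    rw [hk]; push_cast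
    have h2 : 1 ≤ L / r := by rw [le_div_iff₀ hr]; linarith
    have h3 : 3 * L / r = 2 * L / r + L / r := by ring
    linarith
  have hcard1 : 1 < T.card := by
    have h : (1:ℝ) < T.card := by
      rw [hM]
      exact Real.one_lt_exp_iff.mpr (by linarith)
    exact_mod_cast h
  have hne : Nonempty ι := by
    obtain ⟨a, ha, b, hb, hab⟩ := Finset.one_lt_card.mp hcard1
    obtain ⟨i, -⟩ := Function.ne_iff.mp hab
    exact ⟨i⟩
  have hn : (0:ℝ) < Fintype.card ι := by exact_mod_cast Fintype.card_pos
  have hψ : ∃ ψ : Fin k → ι, Set.InjOn (fun a : ι → Bool => a ∘ ψ) T := by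
    by_contra hcon
    push Not at hcon
    have hcov : (Finset.univ : Finset (Fin k → ι)) ⊆ T.offDiag.biUnion fun ab =>
        Finset.univ.filter fun ψ : Fin k → ι => ∀ i, ab.1 (ψ i) = ab.2 (ψ i) := by
      intro ψ _
      have := hcon ψ
      simp only [Set.InjOn] at this
      push Not at this
      obtain ⟨a, ha, b, hb, hab, hne⟩ := this
      rw [Finset.mem_biUnion]
      refine ⟨(a, b), by simp; exact ⟨ha, hb, hne⟩, ?_⟩
      simp only [Finset.mem_filter, Finset.mem_univ, true_and]
      exact fun i => congrFun hab i
    have h1 := (Finset.card_le_card hcov).trans Finset.card_biUnion_le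
    have h2 : ∀ ab ∈ T.offDiag, ((Finset.univ.filter fun ψ : Fin k → ι =>
        ∀ i, ab.1 (ψ i) = ab.2 (ψ i)).card : ℝ) ≤ (Fintype.card ι) ^ k * Real.exp (-(r * k)) := by
      rintro ⟨a, b⟩ hab
      rw [Finset.mem_offDiag] at hab
      have h3 : (Finset.univ.filter fun ψ : Fin k → ι => ∀ i, a (ψ i) = b (ψ i)) =
          Fintype.piFinset fun _ : Fin k => Finset.univ.filter fun i => a i = b i := by
        ext ψ; simp
      simp only
      rw [h3, Fintype.card_piFinset_const]
      have h4 := hsep a hab.1 b hab.2.1 hab.2.2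
      have h5 : (Finset.univ.filter fun i => a i = b i).card +
          (Finset.univ.filter fun i => a i ≠ b i).card = Fintype.card ι := by
        simpa using Finset.card_filter_add_card_filter_not (s := Finset.univ) (fun i => a i = b i)
      have h5' : ((Finset.univ.filter fun i => a i = b i).card : ℝ) +
          (Finset.univ.filter fun i => a i ≠ b i).card = Fintype.card ι := by exact_mod_cast h5
      have h6 : ((Finset.univ.filter fun i => a i = b i).card : ℝ) ≤
          Fintype.card ι * Real.exp (-r) := by
        have := Real.add_one_le_exp (-r)
        nlinarith
      push_cast
      calc ((Finset.univ.filter fun i => a i = b i).card : ℝ) ^ k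
          ≤ (Fintype.card ι * Real.exp (-r)) ^ k := pow_le_pow_left₀ (Nat.cast_nonneg _) h6 _
        _ = (Fintype.card ι : ℝ) ^ k * Real.exp (-(r * k)) := by
          rw [mul_pow, ← Real.exp_nat_mul]
          congr 2
          ring
    have h3 : ((Fintype.card (Fin k → ι) : ℕ) : ℝ) ≤
        T.offDiag.card * ((Fintype.card ι) ^ k * Real.exp (-(r * k))) := by
      rw [← nsmul_eq_mul]
      refine le_trans ?_ (Finset.sum_le_card_nsmul _ _ _ h2)
      exact_mod_cast h1
    have h4 : (T.offDiag.card : ℝ) ≤ Real.exp (2 * L) := by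
      have : T.offDiag.card ≤ T.card * T.card := by rw [Finset.offDiag_card]; omega
      have : (T.offDiag.card : ℝ) ≤ T.card * T.card := by exact_mod_cast this
      rw [hM, ← Real.exp_add] at this
      convert this using 2; ring
    rw [Fintype.card_fun, Fintype.card_fin] at h3
    push_cast at h3
    have h5 : Real.exp (2 * L) * Real.exp (-(r * k)) < 1 := by
      rw [← Real.exp_add, Real.exp_lt_one_iff]
      rw [div_lt_iff₀ hr] at hk1
      nlinarith
    have h6 : (0:ℝ) < (Fintype.card ι : ℝ) ^ k := by positivity
    have h7 : (T.offDiag.card : ℝ) * ((Fintype.card ι) ^ k * Real.exp (-(r * k))) ≤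
        Real.exp (2 * L) * ((Fintype.card ι) ^ k * Real.exp (-(r * k))) :=
      mul_le_mul_of_nonneg_right h4 (by positivity)
    nlinarith
  obtain ⟨ψ, hψ⟩ := hψ
  have h1 := hg k (by omega) ψ
  rw [Finset.card_image_of_injOn hψ] at h1
  have hkpos : (0:ℝ) < k := by exact_mod_cast (by omega : 0 < k)
  have h2 : L ≤ d * Real.log (B * k) := by
    rw [hLdef, ← Real.log_pow]
    exact Real.log_le_log hTpos h1
  have h3 : Real.log (B * k) ≤ Real.log (6 * B * d / r) + L / (2 * d) := by
    have hle : B * k ≤ (6 * B * d / r) * (L / (2 * d)) := by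
      have : (6 * B * d / r) * (L / (2 * d)) = B * (3 * L / r) := by
        field_simp; ring
      rw [this]
      exact mul_le_mul_of_nonneg_left hk2 (by linarith)
    have hp : 0 < L / (2 * d) := by positivity
    refine (Real.log_le_log (by positivity) hle).trans ?_
    rw [Real.log_mul (by linarith) hp.ne']
    have := Real.log_le_sub_one_of_pos hp
    linarith
  have h4 : d * Real.log (B * k) ≤ d * Real.log (6 * B * d / r) + L / 2 := by
    have := mul_le_mul_of_nonneg_left h3 (show (0:ℝ) ≤ d by linarith)
    have h5 : d * (Real.log (6 * B * d / r) + L / (2 * d)) =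
      d * Real.log (6 * B * d / r) + L / 2 := by field_simp
    linarith
  linarith

/-- signed sum -/
noncomputable def rad {m : ℕ} (σ : Fin m → Bool) (v : Fin m → ℝ) : ℝ :=
  ∑ j, if σ j then - v j else v j

theorem rad_sub {m : ℕ} (σ : Fin m → Bool) (v w : Fin m → ℝ) :
    rad σ (fun j => v j - w j) = rad σ v - rad σ w := by
  simp only [rad, ← Finset.sum_sub_distrib]
  refine Finset.sum_congr rfl fun j _ => ?_
  split_ifs <;> ring

theorem rad_neg {m : ℕ} (σ : Fin m → Bool) (v : Fin m → ℝ) :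
    rad σ (fun j => - v j) = - rad σ v := by
  simp only [rad, ← Finset.sum_neg_distrib]
  refine Finset.sum_congr rfl fun j _ => ?_
  split_ifs <;> ring

theorem rad_one_sided {m : ℕ} (v : Fin m → ℝ) {S τ : ℝ} (hS : 0 < S) (hv : ∑ j, v j ^ 2 ≤ S)
    (hτ : 0 ≤ τ) :
    ((Finset.univ.filter fun σ : Fin m → Bool => τ < rad σ v).card : ℝ) ≤
      2 ^ m * Real.exp (-(τ ^ 2 / (2 * S))) := by
  set l := τ / S with hl
  have hl0 : 0 ≤ l := by positivity
  have h1 : ∑ σ : Fin m → Bool, Real.exp (l * rad σ v) ≤ 2 ^ m * Real.exp (l ^ 2 * S / 2) := by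
    have h2 : ∀ σ : Fin m → Bool, Real.exp (l * rad σ v) =
        ∏ j, Real.exp (l * (if σ j then - v j else v j)) := by
      intro σ
      rw [← Real.exp_sum, rad, Finset.mul_sum]
    simp_rw [h2]
    have h3 := (Finset.prod_univ_sum (fun _ : Fin m => (Finset.univ : Finset Bool))
      (fun j b => Real.exp (l * (if b then - v j else v j)))).symm
    rw [Fintype.piFinset_univ] at h3
    rw [h3]
    calc ∏ j, ∑ b : Bool, Real.exp (l * (if b then - v j else v j))
        ≤ ∏ j, (2 * Real.exp (l ^ 2 * v j ^ 2 / 2)) := by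
          refine Finset.prod_le_prod (fun j _ => Finset.sum_nonneg fun b _ => (Real.exp_pos _).le)
            fun j _ => ?_
          have := Real.cosh_le_exp_half_sq (l * v j)
          rw [Real.cosh_eq] at this
          simp only [Fintype.sum_bool, if_true, Bool.false_eq_true, if_false, mul_neg]
          rw [mul_pow] at this
          linarith
      _ = 2 ^ m * Real.exp (l ^ 2 * (∑ j, v j ^ 2) / 2) := by
          rw [Finset.prod_mul_distrib, ← Real.exp_sum]
          simp [Finset.mul_sum, Finset.sum_div]
      _ ≤ _ := by gcongr
  have h2 : ((Finset.univ.filter fun σ : Fin m → Bool => τ < rad σ v).card : ℝ) *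
      Real.exp (l * τ) ≤ ∑ σ : Fin m → Bool, Real.exp (l * rad σ v) := by
    rw [← nsmul_eq_mul]
    refine (Finset.card_nsmul_le_sum _ (fun σ => Real.exp (l * rad σ v)) _ fun σ hσ => ?_).trans
      (Finset.sum_le_sum_of_subset_of_nonneg (Finset.filter_subset _ _)
        fun _ _ _ => (Real.exp_pos _).le)
    rw [Finset.mem_filter] at hσ
    exact Real.exp_le_exp.mpr (mul_le_mul_of_nonneg_left hσ.2.le hl0)
  have h3 := h2.trans h1
  rw [← le_div_iff₀ (Real.exp_pos _), mul_div_assoc, ← Real.exp_sub] at h3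
  have h4 : l ^ 2 * S / 2 - l * τ = -(τ ^ 2 / (2 * S)) := by
    rw [hl]; field_simp; ring
  rwa [h4] at h3

theorem rad_two_sided {m : ℕ} (v : Fin m → ℝ) {S τ : ℝ} (hS : 0 < S) (hv : ∑ j, v j ^ 2 ≤ S)
    (hτ : 0 ≤ τ) :
    ((Finset.univ.filter fun σ : Fin m → Bool => τ < |rad σ v|).card : ℝ) ≤
      2 ^ m * (2 * Real.exp (-(τ ^ 2 / (2 * S)))) := by
  classical
  have h1 := rad_one_sided v hS hv hτ
  have h2 := rad_one_sided (fun j => - v j) hS (by simpa using hv) hτ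
  have h3 : (Finset.univ.filter fun σ : Fin m → Bool => τ < |rad σ v|) ⊆
      (Finset.univ.filter fun σ : Fin m → Bool => τ < rad σ v) ∪
      (Finset.univ.filter fun σ : Fin m → Bool => τ < rad σ fun j => - v j) := by
    intro σ
    simp only [Finset.mem_filter, Finset.mem_univ, true_and, Finset.mem_union, rad_neg]
    exact lt_abs.mp
  have h4 : ((Finset.univ.filter fun σ : Fin m → Bool => τ < |rad σ v|).card : ℝ) ≤
      (Finset.univ.filter fun σ : Fin m → Bool => τ < rad σ v).card +
      (Finset.univ.filter fun σ : Fin m → Bool => τ < rad σ fun j => - v j).card := by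
    exact_mod_cast (Finset.card_le_card h3).trans (Finset.card_union_le _ _)
  linarith

theorem exists_net {ι : Type*} [Fintype ι] [DecidableEq ι] (C : Finset (ι → Bool)) (ρ : ℝ)
    (hρ : 0 ≤ ρ) :
    ∃ T ⊆ C, (∀ a ∈ T, ∀ b ∈ T, a ≠ b →
      ρ < ((Finset.univ.filter fun i => a i ≠ b i).card : ℝ)) ∧
      ∀ a ∈ C, ∃ b ∈ T, ((Finset.univ.filter fun i => a i ≠ b i).card : ℝ) ≤ ρ := by
  classical
  let sep : Finset (ι → Bool) → Prop := fun T => ∀ a ∈ T, ∀ b ∈ T, a ≠ b →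
      ρ < ((Finset.univ.filter fun i => a i ≠ b i).card : ℝ)
  obtain ⟨T, hT⟩ := (C.powerset.filter sep).exists_maximal ⟨∅, by simp [sep]⟩
  have hT1 := hT.prop
  rw [Finset.mem_filter, Finset.mem_powerset] at hT1
  refine ⟨T, hT1.1, hT1.2, fun a ha => ?_⟩
  by_contra hcon
  push Not at hcon
  have haT : a ∉ T := fun h => by
    have := hcon a h
    simp at this
    linarith
  have hins : insert a T ∈ C.powerset.filter sep := by
    rw [Finset.mem_filter, Finset.mem_powerset]
    refine ⟨Finset.insert_subset ha hT1.1, ?_⟩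
    intro x hx y hy hxy
    rw [Finset.mem_insert] at hx hy
    rcases hx with rfl | hx <;> rcases hy with rfl | hy
    · exact (hxy rfl).elim
    · exact hcon y hy
    · have := hcon x hx
      simpa only [ne_comm] using this
    · exact hT1.2 x hx y hy hxy
  exact haT (hT.le_of_ge hins (Finset.subset_insert a T) (Finset.mem_insert_self a T))

/-- difference vector on paired sample -/
def dv {m : ℕ} (a : Fin m × Bool → Bool) (j : Fin m) : ℝ :=
  (if a (j, false) then 1 else 0) - (if a (j, true) then 1 else 0)

theorem dv_sq_le {m : ℕ} (a b : Fin m × Bool → Bool) :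
    ∑ j, (dv a j - dv b j) ^ 2 ≤ 2 * ((Finset.univ.filter fun i => a i ≠ b i).card : ℝ) := by
  rw [Finset.card_filter, Nat.cast_sum, Fintype.sum_prod_type, Finset.mul_sum]
  refine Finset.sum_le_sum fun j _ => ?_
  simp only [dv, Fintype.sum_bool]
  cases a (j, false) <;> cases a (j, true) <;> cases b (j, false) <;> cases b (j, true) <;> norm_num

theorem chaining {m d : ℕ} {B ε δ : ℝ} (hm : 0 < m) (hd : 1 ≤ d) (hB : 1 ≤ B) (hε : 0 < ε)
    (hδ : 0 < δ) (hδ1 : δ ≤ 1)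
    (C : Finset (Fin m × Bool → Bool))
    (hg : ∀ k : ℕ, 1 ≤ k → ∀ ψ : Fin k → Fin m × Bool,
      ((C.image fun a => a ∘ ψ).card : ℝ) ≤ (B * k) ^ d)
    (hE : 2 * d * Real.log (6 * B * d) + Real.log (4 / δ) ≤ m * ε ^ 2 / 288) :
    ((Finset.univ.filter fun σ : Fin m → Bool => ∃ a ∈ C, m * ε < |rad σ (dv a)|).card : ℝ) ≤
      2 ^ m * δ := by
  classical
  have hd' : (1:ℝ) ≤ d := by exact_mod_cast hd
  have hm' : (0:ℝ) < m := by exact_mod_cast hm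
  set W := 2 * d * Real.log (6 * B * d) with hW
  have hBd : 1 ≤ B * d := by nlinarith
  have hlog : Real.log 4 ≤ Real.log (6 * B * d) := Real.log_le_log (by norm_num) (by nlinarith)
  have hlog4 : 0 ≤ Real.log 4 := Real.log_nonneg (by norm_num)
  have hW0 : 0 ≤ W := by rw [hW]; have := hlog4.trans hlog; positivity
  have hnet : ∀ k : ℕ, ∃ T : Finset (Fin m × Bool → Bool),
      (∀ a ∈ C, ∃ b ∈ T, ((Finset.univ.filter fun i => a i ≠ b i).card : ℝ) ≤ (1/4) ^ k * (2 * m)) ∧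
      (T.card : ℝ) ≤ Real.exp (W * (k + 1)) ∧ (1 ≤ k → T ⊆ C) ∧
      (k = 0 → T = {fun _ => false}) := by
    intro k
    rcases Nat.eq_zero_or_pos k with rfl | hk
    · refine ⟨{fun _ => false}, fun a _ => ⟨_, Finset.mem_singleton_self _, ?_⟩, ?_, by omega, fun _ => rfl⟩
      · have : (Finset.univ.filter fun i : Fin m × Bool => a i ≠ false).card ≤ m * 2 := by
          simpa using Finset.card_filter_le (Finset.univ : Finset (Fin m × Bool)) (fun i => a i ≠ false)
        have : ((Finset.univ.filter fun i : Fin m × Bool => a i ≠ false).card : ℝ) ≤ m * 2 := by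
          exact_mod_cast this
        linarith
      · simp; linarith
    · obtain ⟨T, hTC, hsep, hcov⟩ := exists_net C ((1/4) ^ k * (2 * m)) (by positivity)
      refine ⟨T, hcov, ?_, fun _ => hTC, by omega⟩
      have hp := packing T (r := (1/4) ^ k) (B := B) (d := d) (by positivity)
        (pow_le_one₀ (by norm_num) (by norm_num)) hB hd
        (by
          intro a ha b hb hab
          have := hsep a ha b hb hab
          simpa [mul_comm] using this)
        (fun k hk ψ => le_trans (by exact_mod_cast Finset.card_le_card (Finset.image_subset_image hTC))
          (hg k hk ψ))
      rcases Nat.eq_zero_or_pos T.card with h0 | h0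
      · rw [h0]; simp; positivity
      · rw [← Real.log_le_iff_le_exp (by exact_mod_cast h0)]
        refine hp.trans ?_
        have h6 : 6 * B * d / (1/4) ^ k = (6 * B * d) * 4 ^ k := by
          rw [one_div, inv_pow, div_inv_eq_mul]
        rw [h6, Real.log_mul (by nlinarith) (by positivity), Real.log_pow]
        have : (k:ℝ) * Real.log 4 ≤ k * Real.log (6 * B * d) :=
          mul_le_mul_of_nonneg_left hlog (by positivity)
        rw [hW]
        have h7 := mul_le_mul_of_nonneg_left this (show (0:ℝ) ≤ 2 * d by positivity)
        nlinarith
  choose T hcov hcard hTC hT0 using hnet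
  choose! pr hprT hprd using hcov
  let t : ℕ → ℝ := fun k => ε / 3 * (3/4) ^ k
  let E : ℕ → Finset (Fin m → Bool) := fun k => (T (k+1)).biUnion fun a =>
    Finset.univ.filter fun σ => m * t (k+1) < |rad σ fun j => dv a j - dv (pr k a) j|
  -- bound of each event
  have hEk : ∀ k, ((E k).card : ℝ) ≤ 2 ^ m * (δ / 2 * (1/4) ^ k) := by
    intro k
    have h1 : ((E k).card : ℝ) ≤ ∑ a ∈ T (k+1), ((Finset.univ.filter fun σ : Fin m → Bool =>
        m * t (k+1) < |rad σ fun j => dv a j - dv (pr k a) j|).card : ℝ) := by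
      exact_mod_cast Finset.card_biUnion_le
    set S := 4 * (m:ℝ) * (1/4) ^ k with hS
    have hS0 : 0 < S := by positivity
    have h2 : ∀ a ∈ T (k+1), ((Finset.univ.filter fun σ : Fin m → Bool =>
        m * t (k+1) < |rad σ fun j => dv a j - dv (pr k a) j|).card : ℝ) ≤
        2 ^ m * (2 * Real.exp (-((m * t (k+1)) ^ 2 / (2 * S)))) := by
      intro a ha
      refine rad_two_sided _ hS0 ?_ (by positivity)
      refine (dv_sq_le a (pr k a)).trans ?_
      have := hprd k a (hTC (k+1) (by omega) ha)
      rw [hS]; linarith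
    have h3 := h1.trans (Finset.sum_le_card_nsmul _ _ _ h2)
    rw [nsmul_eq_mul] at h3
    refine h3.trans ?_
    have h4 : (m * t (k+1)) ^ 2 / (2 * S) = m * ε ^ 2 / 288 * (9/4) ^ (k+1) := by
      rw [hS]
      simp only [t]
      have e1 : ((3:ℝ)/4) ^ (k+1) * (3/4) ^ (k+1) = (9/16) ^ (k+1) := by
        rw [← mul_pow]; norm_num
      have e2 : ((9:ℝ)/16) ^ (k+1) = (9/4) ^ (k+1) * (1/4) ^ (k+1) := by
        rw [← mul_pow]; norm_num
      have e3 : (m * (ε / 3 * (3/4) ^ (k+1))) ^ 2 =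
        m ^ 2 * ε ^ 2 / 9 * ((9/4) ^ (k+1) * ((1/4) ^ k * (1/4))) := by
        rw [← pow_succ, ← e2, ← e1]; ring
      rw [e3]
      field_simp
      ring
    have h5 : ((k+1 : ℕ) : ℝ) + 1 ≤ (9/4) ^ (k+1) := by
      have := one_add_mul_le_pow (show (-2:ℝ) ≤ 5/4 by norm_num) (k+1)
      have e : (1:ℝ) + 5/4 = 9/4 := by norm_num
      rw [e] at this
      have : (0:ℝ) ≤ ((k+1:ℕ):ℝ) := by positivity
      linarith
    have hD : Real.log (4/δ) ≤ m * ε ^ 2 / 288 - W := by linarith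
    have hD0 : 0 ≤ Real.log (4/δ) := Real.log_nonneg (by rw [le_div_iff₀ hδ]; linarith)
    have h6 : (T (k+1)).card * Real.exp (-((m * t (k+1)) ^ 2 / (2 * S))) ≤ (δ/4) ^ (k+2) := by
      calc (T (k+1)).card * Real.exp (-((m * t (k+1)) ^ 2 / (2 * S)))
          ≤ Real.exp (W * ((k+1:ℕ) + 1)) * Real.exp (-(m * ε ^ 2 / 288 * ((k+1:ℕ) + 1))) := by
            refine mul_le_mul (hcard (k+1)) ?_ (Real.exp_pos _).le (Real.exp_pos _).le
            rw [h4]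
            refine Real.exp_le_exp.mpr (neg_le_neg ?_)
            exact mul_le_mul_of_nonneg_left h5 (by positivity)
        _ = Real.exp (-((m * ε ^ 2 / 288 - W) * ((k+1:ℕ) + 1))) := by
            rw [← Real.exp_add]; ring_nf
        _ ≤ Real.exp (-(Real.log (4/δ) * ((k+1:ℕ) + 1))) := by
            refine Real.exp_le_exp.mpr (neg_le_neg ?_)
            exact mul_le_mul_of_nonneg_right hD (by positivity)
        _ = (δ/4) ^ (k+2) := by
            rw [← neg_mul, ← Real.log_inv, inv_div, mul_comm]
            have : (((k+1:ℕ):ℝ) + 1) = ((k+2 : ℕ) : ℝ) := by push_cast; ring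
            rw [this, Real.exp_nat_mul, Real.exp_log (by positivity)]
    have h7 : (δ/4) ^ (k+2) ≤ δ / 4 * (1/4) ^ k := by
      have a1 : (δ/4) ^ k ≤ (1/4) ^ k := pow_le_pow_left₀ (by positivity) (by linarith) _
      have a2 : (δ/4) ^ 2 ≤ δ/4 := by nlinarith
      rw [pow_add, mul_comm]
      exact mul_le_mul a2 a1 (by positivity) (by positivity)
    have h8 : (0:ℝ) < 2 ^ m := by positivity
    have h9 := mul_le_mul_of_nonneg_left (h6.trans h7) (show (0:ℝ) ≤ 2 ^ m * 2 by positivity)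
    linarith
  -- the last level
  obtain ⟨K, hK⟩ : ∃ K : ℕ, (1/4 : ℝ) ^ K * (2 * m) < 1 ∧ 1 ≤ K := by
    have h1 : Filter.Tendsto (fun K : ℕ => (1/4 : ℝ) ^ K * (2 * m)) Filter.atTop (nhds (0 * (2 * m))) :=
      (tendsto_pow_atTop_nhds_zero_of_lt_one (by norm_num) (by norm_num)).mul_const _
    rw [zero_mul] at h1
    exact ((h1.eventually_lt_const zero_lt_one).and (Filter.eventually_ge_atTop 1)).exists
  have hsub : (Finset.univ.filter fun σ : Fin m → Bool => ∃ a ∈ C, m * ε < |rad σ (dv a)|) ⊆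
      (Finset.range K).biUnion E := by
    intro σ hσ
    by_contra hcon
    rw [Finset.mem_biUnion] at hcon
    push Not at hcon
    have hind : ∀ k ≤ K, ∀ a ∈ T k, |rad σ (dv a)| ≤ m * ∑ i ∈ Finset.range k, t (i+1) := by
      intro k
      induction k with
      | zero =>
        intro _ a ha
        rw [hT0 0 rfl, Finset.mem_singleton] at ha
        subst ha
        simp [rad, dv]
      | succ k ih =>
        intro hk a ha
        have h1 := hcon k (Finset.mem_range.mpr (by omega))
        simp only [E, Finset.mem_biUnion, Finset.mem_filter, Finset.mem_univ, true_and] at h1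
        push Not at h1
        have h2 := h1 a ha
        rw [rad_sub] at h2
        have h3 := ih (by omega) (pr k a) (hprT k a (hTC (k+1) (by omega) ha))
        rw [Finset.sum_range_succ, mul_add]
        have : |rad σ (dv a)| ≤ |rad σ (dv (pr k a))| + |rad σ (dv a) - rad σ (dv (pr k a))| := by
          have := abs_add_le (rad σ (dv (pr k a))) (rad σ (dv a) - rad σ (dv (pr k a)))
          simpa using this
        linarith
    rw [Finset.mem_filter] at hσ
    obtain ⟨-, a, ha, hbad⟩ := hσ
    have hab : a = pr K a := by
      have h1 := (hprd K a ha).trans_lt hK.1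
      have h2 : (Finset.univ.filter fun i => a i ≠ pr K a i).card = 0 := by
        have : (Finset.univ.filter fun i => a i ≠ pr K a i).card < 1 := by exact_mod_cast h1
        omega
      rw [Finset.card_eq_zero, Finset.filter_eq_empty_iff] at h2
      funext i
      simpa using h2 (Finset.mem_univ i)
    have h1 := hind K le_rfl (pr K a) (hprT K a ha)
    rw [← hab] at h1
    have h2 : ∑ i ∈ Finset.range K, t (i+1) ≤ ε := by
      have h3 : ∀ K : ℕ, ∑ i ∈ Finset.range K, t (i+1) = ε - ε * (3/4) ^ K := by
        intro K
        induction K with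
        | zero => simp
        | succ K ih => rw [Finset.sum_range_succ, ih]; simp only [t]; ring
      rw [h3]
      have : 0 ≤ ε * (3/4 : ℝ) ^ K := by positivity
      linarith
    have := mul_le_mul_of_nonneg_left h2 hm'.le
    linarith
  have h1 : ((Finset.univ.filter fun σ : Fin m → Bool => ∃ a ∈ C, m * ε < |rad σ (dv a)|).card : ℝ) ≤
      ∑ k ∈ Finset.range K, ((E k).card : ℝ) := by
    exact_mod_cast (Finset.card_le_card hsub).trans Finset.card_biUnion_le
  refine h1.trans ((Finset.sum_le_sum fun k _ => hEk k).trans ?_)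
  rw [← Finset.mul_sum, ← Finset.mul_sum]
  refine mul_le_mul_of_nonneg_left ?_ (by positivity)
  have h3 : ∀ K : ℕ, ∑ i ∈ Finset.range K, (1/4:ℝ) ^ i = 4/3 - 4/3 * (1/4) ^ K := by
    intro K
    induction K with
    | zero => simp
    | succ K ih => rw [Finset.sum_range_succ, ih]; ring
  rw [h3]
  have : 0 ≤ (1/4 : ℝ) ^ K := by positivity
  nlinarith

end GDPW

namespace GDPW

theorem second_moment {Z : Type*} [Fintype Z] (c : Z → ℝ) (h0 : ∑ z, c z = 0)
    (h1 : ∀ z, |c z| ≤ 1) (m : ℕ) :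
    ∑ φ : Fin m → Z, (∑ j, c (φ j)) ^ 2 ≤ m * (Fintype.card Z : ℝ) ^ m := by
  induction m with
  | zero => simp
  | succ m ih =>
    rw [← (Fin.consEquiv (fun _ : Fin (m+1) => Z)).sum_comp, Fintype.sum_prod_type]
    have e : ∀ z : Z, ∀ φ : Fin m → Z,
        (∑ j, c ((Fin.consEquiv (fun _ : Fin (m+1) => Z)) (z, φ) j)) ^ 2
          = c z ^ 2 + 2 * c z * (∑ j, c (φ j)) + (∑ j, c (φ j)) ^ 2 := by
      intro z φ
      rw [Fin.sum_univ_succ]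
      simp only [Fin.consEquiv, Equiv.coe_fn_mk, Fin.cons_zero, Fin.cons_succ]
      ring
    simp only [e, Finset.sum_add_distrib, ← Finset.mul_sum]
    rw [← Finset.sum_mul, ← Finset.mul_sum, h0]
    simp only [Finset.sum_const, Finset.card_univ, Fintype.card_pi, Finset.prod_const,
      Fintype.card_fin, nsmul_eq_mul]
    rw [← Finset.mul_sum]
    have h2 : ∑ z, c z ^ 2 ≤ Fintype.card Z := by
      have : ∑ z, c z ^ 2 ≤ ∑ z : Z, (1:ℝ) := by
        refine Finset.sum_le_sum fun z _ => ?_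
        rw [← sq_abs]; have := h1 z; have := abs_nonneg (c z); nlinarith
      simpa using this
    have hN : (0:ℝ) ≤ Fintype.card Z := by positivity
    have h3 := mul_le_mul_of_nonneg_left h2 (pow_nonneg hN m)
    have h4 := mul_le_mul_of_nonneg_left ih hN
    push_cast
    have e2 : (Fintype.card Z : ℝ) ^ (m+1) = Fintype.card Z ^ m * Fintype.card Z := pow_succ _ _
    rw [e2]
    nlinarith

theorem chebyshev_count {Z : Type*} [Fintype Z] (c : Z → ℝ) (h0 : ∑ z, c z = 0)
    (h1 : ∀ z, |c z| ≤ 1) (m : ℕ) {t : ℝ} (ht : 0 < t) (hmt : 2 * m ≤ t ^ 2) :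
    (Fintype.card Z : ℝ) ^ m / 2 ≤
      ((Finset.univ.filter fun φ : Fin m → Z => |∑ j, c (φ j)| ≤ t).card : ℝ) := by
  classical
  have h2 := second_moment c h0 h1 m
  have h3 : ((Finset.univ.filter fun φ : Fin m → Z => ¬ |∑ j, c (φ j)| ≤ t).card : ℝ) * t ^ 2 ≤
      ∑ φ : Fin m → Z, (∑ j, c (φ j)) ^ 2 := by
    rw [← nsmul_eq_mul]
    refine (Finset.card_nsmul_le_sum _ (fun φ => (∑ j, c (φ j)) ^ 2) _ ?_).trans ?_
    · intro φ hφ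
      have := (Finset.mem_filter.1 hφ).2
      rw [← sq_abs (∑ j, c (φ j))]
      exact pow_le_pow_left₀ ht.le (not_le.1 this).le 2
    · exact Finset.sum_le_sum_of_subset_of_nonneg (Finset.filter_subset _ _) fun _ _ _ => sq_nonneg _
  have h5 := Finset.card_filter_add_card_filter_not (s := (Finset.univ : Finset (Fin m → Z)))
    (fun φ => |∑ j, c (φ j)| ≤ t)
  rw [Finset.card_univ, Fintype.card_pi, Finset.prod_const, Finset.card_univ, Fintype.card_fin] at h5
  have h5' : ((Finset.univ.filter fun φ : Fin m → Z => |∑ j, c (φ j)| ≤ t).card : ℝ) +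
    ((Finset.univ.filter fun φ : Fin m → Z => ¬ |∑ j, c (φ j)| ≤ t).card : ℝ)
      = (Fintype.card Z : ℝ) ^ m := by exact_mod_cast h5
  set n := ((Finset.univ.filter fun φ : Fin m → Z => ¬ |∑ j, c (φ j)| ≤ t).card : ℝ)
  have hp : (0:ℝ) ≤ (Fintype.card Z : ℝ) ^ m := by positivity
  have h6 : n * t ^ 2 ≤ (Fintype.card Z : ℝ) ^ m / 2 * t ^ 2 := by nlinarith
  have := le_of_mul_le_mul_right h6 (by positivity)
  linarith

/-- indicator of a Boolean -/
noncomputable def bi (b : Bool) : ℝ := if b then 1 else 0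

theorem swap_count {Z : Type*} [Fintype Z] [DecidableEq Z] {m d : ℕ} {B ε δ : ℝ} (hm : 0 < m)
    (hd : 1 ≤ d) (hB : 1 ≤ B) (hε : 0 < ε) (hδ : 0 < δ) (hδ1 : δ ≤ 1)
    (C : Finset (Z → Bool))
    (hg : ∀ k ≥ 1, ∀ ψ : Fin k → Z, ((C.image fun a => a ∘ ψ).card : ℝ) ≤ (B * k) ^ d)
    (hE : 2 * d * Real.log (6 * B * d) + Real.log (4 / δ) ≤ m * ε ^ 2 / 288) :
    ((Finset.univ.filter fun χ : Fin m × Bool → Z =>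
      ∃ a ∈ C, m * ε < |∑ j, dv (a ∘ χ) j|).card : ℝ) ≤
      δ * (Fintype.card (Fin m × Bool → Z)) := by
  classical
  let sw : (Fin m → Bool) → (Fin m × Bool) → (Fin m × Bool) := fun σ q => (q.1, xor q.2 (σ q.1))
  have hsw : ∀ σ, Function.Involutive (sw σ) := by
    intro σ q; simp [sw]
  let e : (Fin m → Bool) → Equiv.Perm (Fin m × Bool → Z) := fun σ =>
    Equiv.arrowCongr (hsw σ).toPerm (Equiv.refl Z)
  have he : ∀ σ χ, e σ χ = χ ∘ sw σ := by
    intro σ χ; funext q; rfl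
  have hr : ∀ σ (a : Z → Bool) χ, rad σ (dv (a ∘ χ)) = ∑ j, dv (a ∘ e σ χ) j := by
    intro σ a χ
    refine Finset.sum_congr rfl fun j _ => ?_
    rw [he]
    cases hj : σ j <;> simp [dv, sw, hj]
  have hc : ∀ σ, (Finset.univ.filter fun χ : Fin m × Bool → Z =>
      ∃ a ∈ C, m * ε < |rad σ (dv (a ∘ χ))|).card =
      (Finset.univ.filter fun χ : Fin m × Bool → Z =>
      ∃ a ∈ C, m * ε < |∑ j, dv (a ∘ χ) j|).card := by
    intro σ
    refine Finset.card_equiv (e σ) fun χ => ?_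
    simp [hr]
  have h1 : ∑ σ : Fin m → Bool, (Finset.univ.filter fun χ : Fin m × Bool → Z =>
      ∃ a ∈ C, m * ε < |rad σ (dv (a ∘ χ))|).card =
      ∑ χ : Fin m × Bool → Z, (Finset.univ.filter fun σ : Fin m → Bool =>
      ∃ a ∈ C, m * ε < |rad σ (dv (a ∘ χ))|).card := by
    simp only [Finset.card_filter]
    exact Finset.sum_comm
  have h2 : ∀ χ : Fin m × Bool → Z, ((Finset.univ.filter fun σ : Fin m → Bool =>
      ∃ a ∈ C, m * ε < |rad σ (dv (a ∘ χ))|).card : ℝ) ≤ 2 ^ m * δ := by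
    intro χ
    have := chaining hm hd hB hε hδ hδ1 (C.image fun a => a ∘ χ) (by
      intro k hk ψ
      rw [Finset.image_image]
      exact hg k hk (χ ∘ ψ)) hE
    simpa using this
  simp only [hc, Finset.sum_const, Finset.card_univ, Fintype.card_pi, Finset.prod_const,
    Fintype.card_bool, Fintype.card_fin, smul_eq_mul] at h1
  have h3 : (2:ℝ) ^ m * ((Finset.univ.filter fun χ : Fin m × Bool → Z =>
      ∃ a ∈ C, m * ε < |∑ j, dv (a ∘ χ) j|).card : ℝ) ≤
      Fintype.card (Fin m × Bool → Z) * (2 ^ m * δ) := by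
    have : (2:ℝ) ^ m * ((Finset.univ.filter fun χ : Fin m × Bool → Z =>
      ∃ a ∈ C, m * ε < |∑ j, dv (a ∘ χ) j|).card : ℝ) = ∑ χ : Fin m × Bool → Z, ((Finset.univ.filter fun σ : Fin m → Bool =>
      ∃ a ∈ C, m * ε < |rad σ (dv (a ∘ χ))|).card : ℝ) := by exact_mod_cast h1
    rw [this]
    refine (Finset.sum_le_card_nsmul _ _ _ fun χ _ => h2 χ).trans ?_
    rw [nsmul_eq_mul, Finset.card_univ]
  have h2m : (0:ℝ) < 2 ^ m := by positivity
  refine le_of_mul_le_mul_left (h3.trans (le_of_eq ?_)) h2m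
  ring

theorem vc_finite {Z : Type*} [Fintype Z] [DecidableEq Z] [Nonempty Z] {m d : ℕ} {B ε δ : ℝ}
    (hm : 0 < m)
    (hd : 1 ≤ d) (hB : 1 ≤ B) (hε : 0 < ε) (hδ : 0 < δ) (hδ1 : δ ≤ 1)
    (C : Finset (Z → Bool))
    (hg : ∀ k ≥ 1, ∀ ψ : Fin k → Z, ((C.image fun a => a ∘ ψ).card : ℝ) ≤ (B * k) ^ d)
    (hE : 2 * d * Real.log (6 * B * d) + Real.log (8 / δ) ≤ m * ε ^ 2 / 1152) :
    ((Finset.univ.filter fun φ : Fin m → Z =>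
      ∃ a ∈ C, ε < |(∑ j, bi (a (φ j))) / m - (∑ z, bi (a z)) / Fintype.card Z|).card : ℝ) ≤
      δ * (Fintype.card Z : ℝ) ^ m := by
  classical
  have hm' : (0:ℝ) < m := by exact_mod_cast hm
  have hN : (0:ℝ) < Fintype.card Z := by exact_mod_cast Fintype.card_pos
  let c : (Z → Bool) → Z → ℝ := fun a z => bi (a z) - (∑ z, bi (a z)) / Fintype.card Z
  have hc0 : ∀ a, ∑ z, c a z = 0 := by
    intro a
    simp only [c, Finset.sum_sub_distrib, Finset.sum_const, Finset.card_univ, nsmul_eq_mul]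
    field_simp
    ring
  have hb : ∀ b, 0 ≤ bi b ∧ bi b ≤ 1 := by intro b; cases b <;> simp [bi]
  have hc1 : ∀ a z, |c a z| ≤ 1 := by
    intro a z
    have h1 := hb (a z)
    have h2 : 0 ≤ (∑ z, bi (a z)) / Fintype.card Z :=
      div_nonneg (Finset.sum_nonneg fun z _ => (hb (a z)).1) hN.le
    have h3 : (∑ z, bi (a z)) / Fintype.card Z ≤ 1 := by
      rw [div_le_one hN]
      refine (Finset.sum_le_sum fun z _ => (hb (a z)).2).trans ?_
      simp
    rw [abs_le]; constructor <;> simp only [c] <;> linarith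
  have hsum : ∀ a (φ : Fin m → Z), ∑ j, c a (φ j) =
      m * ((∑ j, bi (a (φ j))) / m - (∑ z, bi (a z)) / Fintype.card Z) := by
    intro a φ
    simp only [c, Finset.sum_sub_distrib, Finset.sum_const, Finset.card_univ, nsmul_eq_mul,
      Fintype.card_fin]
    rw [mul_sub, mul_div_cancel₀ _ hm'.ne']
  have hbad : ∀ a (φ : Fin m → Z), ε < |(∑ j, bi (a (φ j))) / m - (∑ z, bi (a z)) / Fintype.card Z|
      → m * ε < |∑ j, c a (φ j)| := by
    intro a φ h
    rw [hsum, abs_mul, abs_of_pos hm']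
    exact mul_lt_mul_of_pos_left h hm'
  have hlog6 : 0 ≤ 2 * d * Real.log (6 * B * d) := by
    have : (1:ℝ) ≤ d := by exact_mod_cast hd
    have : 1 ≤ 6 * B * d := by nlinarith
    have := Real.log_nonneg this
    positivity
  have hlog8 : 7/8 ≤ Real.log (8/δ) := by
    have h1 := Real.one_sub_inv_le_log_of_pos (x := 8/δ) (by positivity)
    rw [inv_div] at h1
    linarith
  have hmε : 8 ≤ m * ε ^ 2 := by linarith
  have h1 := swap_count hm hd hB (half_pos hε) (half_pos hδ) (by linarith) C hg (by
    have : 4 / (δ/2) = 8/δ := by field_simp; norm_num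
    rw [this]; refine hE.trans (le_of_eq ?_); ring)
  let e : (Fin m × Bool → Z) ≃ (Fin m → Z) × (Fin m → Z) :=
    { toFun := fun χ => (fun j => χ (j, false), fun j => χ (j, true))
      invFun := fun p q => if q.2 then p.2 q.1 else p.1 q.1
      left_inv := by
        intro χ; funext q; rcases q with ⟨j, b⟩; cases b <;> simp
      right_inv := by intro p; simp }
  have h2 : (Finset.univ.filter fun χ : Fin m × Bool → Z =>
      ∃ a ∈ C, m * (ε/2) < |∑ j, dv (a ∘ χ) j|).card =
      ∑ φ : Fin m → Z, (Finset.univ.filter fun φ' : Fin m → Z =>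
        ∃ a ∈ C, m * (ε/2) < |∑ j, dv (a ∘ e.symm (φ, φ')) j|).card := by
    simp only [Finset.card_filter]
    rw [← e.symm.sum_comp, Fintype.sum_prod_type]
  have hdv : ∀ (a : Z → Bool) (φ φ' : Fin m → Z), ∑ j, dv (a ∘ e.symm (φ, φ')) j =
      ∑ j, c a (φ j) - ∑ j, c a (φ' j) := by
    intro a φ φ'
    rw [← Finset.sum_sub_distrib]
    refine Finset.sum_congr rfl fun j _ => ?_
    simp [dv, c, bi, e]
  set Bad := (Finset.univ.filter fun φ : Fin m → Z =>
      ∃ a ∈ C, ε < |(∑ j, bi (a (φ j))) / m - (∑ z, bi (a z)) / Fintype.card Z|) with hBad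
  have h3 : ∀ φ ∈ Bad, (Fintype.card Z : ℝ) ^ m / 2 ≤ ((Finset.univ.filter fun φ' : Fin m → Z =>
        ∃ a ∈ C, m * (ε/2) < |∑ j, dv (a ∘ e.symm (φ, φ')) j|).card : ℝ) := by
    intro φ hφ
    obtain ⟨a, ha, hh⟩ := (Finset.mem_filter.1 hφ).2
    refine (chebyshev_count (c a) (hc0 a) (hc1 a) m (t := m * (ε/2)) (by positivity)
      (by nlinarith)).trans ?_
    norm_cast
    refine Finset.card_le_card ?_
    intro φ' hφ'
    rw [Finset.mem_filter] at hφ' ⊢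
    refine ⟨Finset.mem_univ _, a, ha, ?_⟩
    rw [hdv]
    have := hbad a φ hh
    have h4 := abs_sub_abs_le_abs_sub (∑ j, c a (φ j)) (∑ j, c a (φ' j))
    have := hφ'.2
    linarith
  have h4 : (Bad.card : ℝ) * ((Fintype.card Z : ℝ) ^ m / 2) ≤
      ((Finset.univ.filter fun χ : Fin m × Bool → Z =>
      ∃ a ∈ C, m * (ε/2) < |∑ j, dv (a ∘ χ) j|).card : ℝ) := by
    rw [h2, Nat.cast_sum, ← nsmul_eq_mul]
    refine (Finset.card_nsmul_le_sum Bad _ _ h3).trans ?_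
    exact Finset.sum_le_sum_of_subset_of_nonneg (Finset.subset_univ _) fun _ _ _ => Nat.cast_nonneg _
  have h5 : ((Fintype.card (Fin m × Bool → Z) : ℕ) : ℝ) = (Fintype.card Z : ℝ)^m * (Fintype.card Z : ℝ)^m := by
    rw [Fintype.card_congr e, Fintype.card_prod]
    simp
  rw [h5] at h1
  have hpos : (0:ℝ) < (Fintype.card Z : ℝ)^m / 2 := by positivity
  refine le_of_mul_le_mul_right ((h4.trans h1).trans (le_of_eq ?_)) hpos
  ring

end GDPW

namespace GDPW

theorem sum_levels (H n : ℕ) (h : n ≤ H) :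
    (n : ℝ) = ∑ i ∈ Finset.range H, bi (decide (i < n)) := by
  simp only [bi, decide_eq_true_eq]
  rw [← Finset.sum_filter, Finset.sum_const, nsmul_eq_mul, mul_one]
  have : (Finset.range H).filter (fun i => i < n) = Finset.range n := by
    ext i; simp; omega
  rw [this, Finset.card_range]

theorem levels_finite {X Z : Type*} [Fintype Z] [DecidableEq Z] [Nonempty Z] {m d H : ℕ}
    {B ε δ : ℝ} (hm : 0 < m) (hd : 1 ≤ d) (hH : 1 ≤ H) (hB : 1 ≤ B) (hε : 0 < ε) (hδ : 0 < δ)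
    (hδ1 : δ ≤ 1) (u : X → Z → ℕ) (hu : ∀ x z, u x z ≤ H)
    (hg : ∀ i, ∀ k ≥ 1, ∀ ψ : Fin k → Z,
      ((Set.range fun x => fun j => decide (i < u x (ψ j))).ncard : ℝ) ≤ (B * k) ^ d)
    (hE : 2 * d * Real.log (6 * B * d) + Real.log (8 * H / δ) ≤ m * (ε / H) ^ 2 / 1152) :
    (({φ : Fin m → Z |
      ∃ x, ε < |(∑ j, (u x (φ j) : ℝ)) / m - (∑ z, (u x z : ℝ)) / Fintype.card Z|}.ncard : ℕ) : ℝ) ≤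
      δ * (Fintype.card Z : ℝ) ^ m := by
  classical
  have hH' : (0:ℝ) < H := by exact_mod_cast hH
  have hH1 : (1:ℝ) ≤ H := by exact_mod_cast hH
  let C : ℕ → Finset (Z → Bool) := fun i => (Set.range fun x => fun z => decide (i < u x z)).toFinite.toFinset
  let Bd : ℕ → Finset (Fin m → Z) := fun i => Finset.univ.filter fun φ : Fin m → Z =>
      ∃ a ∈ C i, ε / H < |(∑ j, bi (a (φ j))) / m - (∑ z, bi (a z)) / Fintype.card Z|
  have hBd : ∀ i, ((Bd i).card : ℝ) ≤ δ / H * (Fintype.card Z : ℝ) ^ m := by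
    intro i
    refine vc_finite hm hd hB (div_pos hε hH') (div_pos hδ hH')
      ((div_le_self hδ.le hH1).trans hδ1) (C i) ?_ ?_
    · intro k hk ψ
      refine le_trans (le_of_eq ?_) (hg i k hk ψ)
      rw [← Set.ncard_coe_finset, Finset.coe_image]
      simp only [C, Set.Finite.coe_toFinset, ← Set.range_comp]
      rfl
    · rw [div_div_eq_mul_div]; exact hE
  have hsub : {φ : Fin m → Z |
      ∃ x, ε < |(∑ j, (u x (φ j) : ℝ)) / m - (∑ z, (u x z : ℝ)) / Fintype.card Z|} ⊆
      ((Finset.range H).biUnion Bd : Finset (Fin m → Z)) := by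
    rintro φ ⟨x, hx⟩
    by_contra hcon
    simp only [Finset.coe_biUnion, Set.mem_iUnion, not_exists, Finset.mem_coe, Finset.mem_range] at hcon
    have h1 : ∀ i ∈ Finset.range H, |(∑ j, bi (decide (i < u x (φ j)))) / m -
        (∑ z, bi (decide (i < u x z))) / Fintype.card Z| ≤ ε / H := by
      intro i hi
      have := hcon i (Finset.mem_range.1 hi)
      simp only [Bd, Finset.mem_filter, Finset.mem_univ, true_and, not_exists, not_and, not_lt] at this
      exact this (fun z => decide (i < u x z)) (by simp [C])
    have h2 : (∑ j, (u x (φ j) : ℝ)) / m - (∑ z, (u x z : ℝ)) / Fintype.card Z =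
      ∑ i ∈ Finset.range H, ((∑ j, bi (decide (i < u x (φ j)))) / m -
        (∑ z, bi (decide (i < u x z))) / Fintype.card Z) := by
      rw [Finset.sum_sub_distrib, ← Finset.sum_div, ← Finset.sum_div, Finset.sum_comm,
        Finset.sum_comm (s := Finset.range H)]
      congr 2
      · exact Finset.sum_congr rfl fun j _ => sum_levels H _ (hu _ _)
      · exact Finset.sum_congr rfl fun j _ => sum_levels H _ (hu _ _)
    rw [h2] at hx
    have h3 := (Finset.abs_sum_le_sum_abs _ _).trans (Finset.sum_le_card_nsmul _ _ _ h1)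
    rw [Finset.card_range, nsmul_eq_mul, mul_div_cancel₀ _ hH'.ne'] at h3
    linarith
  have h1 := Set.ncard_le_ncard hsub (Finset.finite_toSet _)
  rw [Set.ncard_coe_finset] at h1
  have h2 := h1.trans Finset.card_biUnion_le
  have h3 : (({φ : Fin m → Z |
      ∃ x, ε < |(∑ j, (u x (φ j) : ℝ)) / m - (∑ z, (u x z : ℝ)) / Fintype.card Z|}.ncard : ℕ) : ℝ) ≤
      ∑ i ∈ Finset.range H, ((Bd i).card : ℝ) := by exact_mod_cast h2
  refine h3.trans ((Finset.sum_le_card_nsmul _ _ _ fun i _ => hBd i).trans (le_of_eq ?_))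
  rw [Finset.card_range, nsmul_eq_mul]
  field_simp

open MvPolynomial in
theorem growth {Ω : Type*} {d H D : ℕ} (hd : 1 ≤ d) (h : Ω → Fin H → MvPolynomial (Fin d) ℝ)
    (hD : ∀ z j, (h z j).totalDegree ≤ D) (u : (Fin d → ℝ) → Ω → ℕ)
    (hu : ∀ x y z, (∀ j, 0 ≤ eval x (h z j) ↔ 0 ≤ eval y (h z j)) → u x z = u y z)
    (i k : ℕ) (hk : 1 ≤ k) (ψ : Fin k → Ω) :
    ((Set.range fun x => fun j => decide (i < u x (ψ j))).ncard : ℝ) ≤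
      ((2 * H * D + 1 : ℝ) * k) ^ d := by
  classical
  set T := (Set.range fun x => fun j => decide (i < u x (ψ j)))
  have hfin : T.Finite := Set.toFinite _
  have : ∀ t : T, ∃ x, (fun j => decide (i < u x (ψ j))) = t.1 := fun t => t.2
  choose r hr using this
  have hinj : Function.Injective r := by
    intro a b hab
    apply Subtype.ext
    rw [← hr a, ← hr b, hab]
  haveI : Fintype T := hfin.fintype
  have h1 := sign_patterns_card_le (D := D) (fun q : Fin k × Fin H => h (ψ q.1) q.2)
    (fun q => hD _ _) (Finset.univ.image r) (by
      intro x hx y hy hxy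
      obtain ⟨a, -, rfl⟩ := Finset.mem_image.1 hx
      obtain ⟨b, -, rfl⟩ := Finset.mem_image.1 hy
      congr 1
      apply Subtype.ext
      rw [← hr a, ← hr b]
      funext j
      rw [hu (r a) (r b) (ψ j) fun l => hxy (j, l)])
  rw [Finset.card_image_of_injective _ hinj, Finset.card_univ, ← Set.toFinset_card,
    ← Set.ncard_eq_toFinset_card'] at h1
  have h2 : (T.ncard : ℝ) ≤ (2 * ((k * H : ℝ) * D) + 1) ^ d := by
    simp only [Fintype.card_prod, Fintype.card_fin] at h1
    exact_mod_cast h1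
  refine h2.trans (pow_le_pow_left₀ (by positivity) ?_ _)
  have : (1:ℝ) ≤ k := by exact_mod_cast hk
  nlinarith

end GDPW

namespace GDPW

theorem pi_precomp {Ω : Type*} [MeasurableSpace Ω] (μ : Measure Ω) [IsProbabilityMeasure μ]
    {ι κ : Type*} [Fintype ι] [Fintype κ] (φ : ι → κ) (hφ : Function.Injective φ) :
    MeasurePreserving (fun s : κ → Ω => s ∘ φ) (Measure.pi fun _ => μ) (Measure.pi fun _ => μ) := by
  classical
  have hmeas : Measurable (fun s : κ → Ω => s ∘ φ) :=
    measurable_pi_lambda _ fun i => measurable_pi_apply (φ i)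
  refine ⟨hmeas, ?_⟩
  symm
  refine Measure.pi_eq fun A hA => ?_
  rw [Measure.map_apply hmeas (MeasurableSet.univ_pi hA)]
  have : (fun s : κ → Ω => s ∘ φ) ⁻¹' (Set.univ.pi A) =
      Set.univ.pi fun j => {w | ∀ i, φ i = j → w ∈ A i} := by
    ext s
    simp only [Set.mem_preimage, Set.mem_univ_pi, Function.comp, Set.mem_ofPred_eq]
    constructor
    · rintro h j i rfl; exact h i
    · intro h i; exact h _ i rfl
  rw [this, Measure.pi_pi]
  symm
  refine Fintype.prod_of_injective φ hφ _ _ ?_ ?_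
  · intro j hj
    have : {w : Ω | ∀ i, φ i = j → w ∈ A i} = Set.univ := by
      ext w; simp only [Set.mem_ofPred_eq, Set.mem_univ, iff_true]
      intro i hi; exact absurd ⟨i, hi⟩ hj
    rw [this, measure_univ]
  · intro i
    congr 1
    ext w
    simp only [Set.mem_ofPred_eq]
    constructor
    · intro h j hj; rw [hφ hj]; exact h
    · intro h; exact h i rfl

theorem reduction {Ω : Type*} [MeasurableSpace Ω] (μ : Measure Ω) [IsProbabilityMeasure μ]
    {m N : ℕ} {δ : ℝ} (hδ : 0 ≤ δ) (Sm : Set (Fin m → Ω)) (SN : Set (Fin N → Ω)) (hSm : MeasurableSet Sm)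
    (hSN : MeasurableSet SN)
    (hred : ∀ s ∉ SN, (({φ : Fin m → Fin N | s ∘ φ ∈ Sm}.ncard : ℕ) : ℝ) ≤ δ * (N : ℝ) ^ m) :
    (Measure.pi fun _ : Fin m => μ).real Sm * (N.descFactorial m : ℝ) ≤
      (δ + (Measure.pi fun _ : Fin N => μ).real SN) * (N : ℝ) ^ m := by
  classical
  have h1 : ∀ φ : Fin m ↪ Fin N, ∫ s, Set.indicator ((fun s : Fin N → Ω => s ∘ φ) ⁻¹' Sm)
      (fun _ => (1:ℝ)) s ∂(Measure.pi fun _ : Fin N => μ) = (Measure.pi fun _ : Fin m => μ).real Sm := by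
    intro φ
    have hp := pi_precomp μ φ φ.injective
    rw [integral_indicator_const _ (hp.measurable hSm), smul_eq_mul, mul_one]
    exact hp.measureReal_preimage hSm.nullMeasurableSet
  have hintg : ∀ {n : ℕ} (S : Set (Fin n → Ω)), MeasurableSet S →
    Integrable (Set.indicator S (fun _ => (1:ℝ))) (Measure.pi fun _ : Fin n => μ) := fun S hS =>
      (integrable_const 1).indicator hS
  have h2 : ∫ s, ∑ φ : Fin m ↪ Fin N, Set.indicator ((fun s : Fin N → Ω => s ∘ φ) ⁻¹' Sm)
      (fun _ => (1:ℝ)) s ∂(Measure.pi fun _ : Fin N => μ) =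
      (Measure.pi fun _ : Fin m => μ).real Sm * (N.descFactorial m : ℝ) := by
    rw [integral_finsetSum _ fun (φ : Fin m ↪ Fin N) _ => hintg _ ((pi_precomp μ φ φ.injective).measurable hSm)]
    simp only [h1, Finset.sum_const, Finset.card_univ, Fintype.card_embedding_eq, Fintype.card_fin,
      nsmul_eq_mul]
    ring
  have h3 : ∫ s, (δ * (N:ℝ)^m + (N:ℝ)^m * Set.indicator SN (fun _ => (1:ℝ)) s)
      ∂(Measure.pi fun _ : Fin N => μ) =
      (δ + (Measure.pi fun _ : Fin N => μ).real SN) * (N : ℝ) ^ m := by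
    rw [integral_add (integrable_const _) ((hintg _ hSN).const_mul _), integral_const_mul (r := (N:ℝ)^m) (f := Set.indicator SN (fun _ => (1:ℝ))),
      integral_indicator_const _ hSN]
    simp
    ring
  rw [← h2, ← h3]
  refine integral_mono (integrable_finsetSum _ fun (φ : Fin m ↪ Fin N) _ =>
    hintg _ ((pi_precomp μ φ φ.injective).measurable hSm))
    ((integrable_const _).add ((hintg _ hSN).const_mul _)) ?_
  intro s
  simp only
  have h4 : ∑ φ : Fin m ↪ Fin N, Set.indicator ((fun s : Fin N → Ω => s ∘ φ) ⁻¹' Sm)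
      (fun _ => (1:ℝ)) s = ((Finset.univ.filter fun φ : Fin m ↪ Fin N => s ∘ φ ∈ Sm).card : ℝ) := by
    rw [Finset.card_filter]
    push_cast
    refine Finset.sum_congr rfl fun φ _ => ?_
    simp [Set.indicator_apply]
  rw [h4]
  have h5 : (Finset.univ.filter fun φ : Fin m ↪ Fin N => s ∘ φ ∈ Sm).card ≤
      {φ : Fin m → Fin N | s ∘ φ ∈ Sm}.ncard := by
    rw [← Set.ncard_coe_finset]
    refine Set.ncard_le_ncard_of_injOn (fun φ => (φ : Fin m → Fin N)) ?_ ?_ (Set.toFinite _)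
    · intro φ hφ; simpa using hφ
    · intro a _ b _ h; exact DFunLike.coe_injective h
  have h6 : (({φ : Fin m → Fin N | s ∘ φ ∈ Sm}.ncard : ℕ) : ℝ) ≤ (N:ℝ) ^ m := by
    have := Set.ncard_le_card {φ : Fin m → Fin N | s ∘ φ ∈ Sm}
    simp at this
    exact_mod_cast this
  have h5' : ((Finset.univ.filter fun φ : Fin m ↪ Fin N => s ∘ φ ∈ Sm).card : ℝ) ≤
    (({φ : Fin m → Fin N | s ∘ φ ∈ Sm}.ncard : ℕ) : ℝ) := by exact_mod_cast h5
  have hδN : 0 ≤ δ * (N:ℝ)^m := by positivity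
  by_cases hs : s ∈ SN
  · simp only [Set.indicator_of_mem hs]
    linarith
  · simp only [Set.indicator_of_notMem hs]
    have := hred s hs
    linarith

theorem descFactorial_ratio (m : ℕ) :
    Filter.Tendsto (fun N : ℕ => (N.descFactorial m : ℝ) / (N:ℝ)^m) Filter.atTop (nhds 1) := by
  induction m with
  | zero => simp
  | succ m ih =>
    have h1 : Filter.Tendsto (fun N : ℕ => 1 - (m:ℝ) / (N:ℝ)) Filter.atTop (nhds 1) := by
      have := (tendsto_const_nhds (x := (1:ℝ))).sub (tendsto_const_div_atTop_nhds_zero_nat (m:ℝ))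
      simpa using this
    have h2 := ih.mul h1
    rw [mul_one] at h2
    refine h2.congr' ?_
    filter_upwards [Filter.eventually_ge_atTop (m+1)] with N hN
    have hN0 : (0:ℝ) < N := by exact_mod_cast (by omega : 0 < N)
    rw [Nat.descFactorial_succ, pow_succ]
    push_cast [Nat.cast_sub (by omega : m ≤ N)]
    field_simp

theorem reduction_limit {Ω : Type*} [MeasurableSpace Ω] (μ : Measure Ω) [IsProbabilityMeasure μ]
    {m : ℕ} {δ : ℝ} (hδ : 0 ≤ δ) (Sm : Set (Fin m → Ω)) (hSm : MeasurableSet Sm)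
    (h : ∀ κ > 0, ∀ N0 : ℕ, ∃ N ≥ N0, ∃ SN : Set (Fin N → Ω), MeasurableSet SN ∧
      (Measure.pi fun _ : Fin N => μ).real SN ≤ κ ∧
      ∀ s ∉ SN, (({φ : Fin m → Fin N | s ∘ φ ∈ Sm}.ncard : ℕ) : ℝ) ≤ δ * (N : ℝ) ^ m) :
    (Measure.pi fun _ : Fin m => μ).real Sm ≤ δ := by
  by_contra hcon
  push Not at hcon
  set p := (Measure.pi fun _ : Fin m => μ).real Sm
  set κ := (p - δ) / 2 with hκ
  have hκ0 : 0 < κ := by rw [hκ]; linarith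
  have h1 := (descFactorial_ratio m).const_mul p
  rw [mul_one] at h1
  have h2 := h1.eventually (lt_mem_nhds (show δ + κ < p by rw [hκ]; linarith))
  obtain ⟨N0, hN0⟩ := Filter.eventually_atTop.1 h2
  obtain ⟨N, hN, SN, hSN, hle, hred⟩ := h κ hκ0 (max N0 1)
  have h3 := reduction μ hδ Sm SN hSm hSN hred
  have h4 := hN0 N (le_trans (le_max_left _ _) hN)
  have hNpos : (0:ℝ) < (N:ℝ)^m := by
    have : 0 < N := lt_of_lt_of_le one_pos (le_trans (le_max_right _ _) hN)
    positivity
  rw [← mul_div_assoc, lt_div_iff₀ hNpos] at h4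
  have h5 := mul_le_mul_of_nonneg_right (add_le_add_right hle δ) hNpos.le
  linarith

end GDPW

namespace GDPW

theorem lln {Ω : Type*} [MeasurableSpace Ω] (μ : Measure Ω) [IsProbabilityMeasure μ]
    (f : Ω → ℝ) (hf : Measurable f) {K : ℝ} (h0 : ∀ z, 0 ≤ f z) (hK : ∀ z, f z ≤ K) {N : ℕ}
    (hN : 0 < N) {t : ℝ} (ht : 0 < t) :
    (Measure.pi fun _ : Fin N => μ).real {s | t < |(∑ j, f (s j)) / N - ∫ z, f z ∂μ|} ≤
      K ^ 2 / (t ^ 2 * N) := by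
  have hN' : (0:ℝ) < N := by exact_mod_cast hN
  have hLp : MemLp f 2 μ := by
    refine MemLp.of_bound hf.aestronglyMeasurable K (Filter.Eventually.of_forall fun z => ?_)
    rw [Real.norm_eq_abs, abs_of_nonneg (h0 z)]; exact hK z
  have hLp' : MemLp (∑ j : Fin N, fun s : Fin N → Ω => f (s j)) 2 (Measure.pi fun _ : Fin N => μ) := by
    refine memLp_finsetSum' _ fun j _ => ?_
    exact hLp.comp_measurePreserving (measurePreserving_eval (fun _ : Fin N => μ) j)
  have hv := ProbabilityTheory.variance_sum_pi (μ := fun _ : Fin N => μ) (X := fun _ => f) fun _ => hLp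
  have hv1 : ProbabilityTheory.variance f μ ≤ K ^ 2 := by
    refine (ProbabilityTheory.variance_le_sq_of_bounded (a := 0) (b := K)
      (Filter.Eventually.of_forall fun z => ⟨h0 z, hK z⟩) hf.aemeasurable).trans ?_
    nlinarith [sq_nonneg K]
  have hE : ∫ s, (∑ j : Fin N, fun s : Fin N → Ω => f (s j)) s ∂(Measure.pi fun _ : Fin N => μ) =
      N * ∫ z, f z ∂μ := by
    simp only [Finset.sum_apply]
    rw [integral_finsetSum]
    · have : ∀ j : Fin N, ∫ s : Fin N → Ω, f (s j) ∂(Measure.pi fun _ : Fin N => μ) = ∫ z, f z ∂μ :=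
        fun j => integral_comp_eval (μ := fun _ : Fin N => μ) (i := j) hf.aestronglyMeasurable
      simp [this]
    · intro j _
      exact (hLp.comp_measurePreserving (measurePreserving_eval (fun _ : Fin N => μ) j)).integrable
        (by norm_num)
  have hc := ProbabilityTheory.meas_ge_le_variance_div_sq hLp' (c := N * t) (by positivity)
  rw [hE, hv] at hc
  have hsub : {s : Fin N → Ω | t < |(∑ j, f (s j)) / N - ∫ z, f z ∂μ|} ⊆
      {s : Fin N → Ω | N * t ≤ |(∑ j : Fin N, fun s : Fin N → Ω => f (s j)) s - N * ∫ z, f z ∂μ|} := by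
    intro s hs
    simp only [Set.mem_ofPred_eq, Finset.sum_apply] at hs ⊢
    have : (∑ j, f (s j)) - N * ∫ z, f z ∂μ = N * ((∑ j, f (s j)) / N - ∫ z, f z ∂μ) := by
      rw [mul_sub, mul_div_cancel₀ _ hN'.ne']
    rw [this, abs_mul, abs_of_pos hN']
    exact mul_le_mul_of_nonneg_left hs.le hN'.le
  refine ENNReal.toReal_le_of_le_ofReal (by positivity) ((measure_mono hsub).trans (hc.trans ?_))
  refine ENNReal.ofReal_le_ofReal ?_
  simp only [Finset.sum_const, Finset.card_univ, Fintype.card_fin, nsmul_eq_mul]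
  rw [div_le_div_iff₀ (by positivity) (by positivity)]
  have : N * ProbabilityTheory.variance f μ ≤ N * K ^ 2 := mul_le_mul_of_nonneg_left hv1 hN'.le
  have h3 := mul_le_mul_of_nonneg_right this (show (0:ℝ) ≤ t ^ 2 * N by positivity)
  refine h3.trans (le_of_eq ?_)
  ring

/-- Samples on which some parameter in `Q` has a large deviation. -/
def badSet {Ω X : Type*} [MeasurableSpace Ω] (μ : Measure Ω) (u : X → Ω → ℕ) (Q : Set X) (n : ℕ)
    (t : ℝ) : Set (Fin n → Ω) :=
  {s | ∃ x ∈ Q, t < |(∑ j, (u x (s j) : ℝ)) / n - ∫ z, (u x z : ℝ) ∂μ|}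

theorem vc_prob {Ω X : Type*} [MeasurableSpace Ω] (μ : Measure Ω) [IsProbabilityMeasure μ]
    {m d H : ℕ} {B ε δ : ℝ} (hm : 0 < m) (hd : 1 ≤ d) (hH : 1 ≤ H) (hB : 1 ≤ B) (hε : 0 < ε)
    (hδ : 0 < δ) (hδ1 : δ ≤ 1) (u : X → Ω → ℕ) (hu : ∀ x z, u x z ≤ H)
    (hg : ∀ i, ∀ k ≥ 1, ∀ ψ : Fin k → Ω,
      ((Set.range fun x => fun j => decide (i < u x (ψ j))).ncard : ℝ) ≤ (B * k) ^ d)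
    (hE : 2 * d * Real.log (6 * B * d) + Real.log (8 * H / δ) ≤ m * (ε / 2 / H) ^ 2 / 1152)
    (Q : Set X) (hmeas : ∀ n t, MeasurableSet (badSet μ u Q n t))
    (hGC : ∀ κ > 0, ∀ N0 : ℕ, ∃ N ≥ N0,
      (Measure.pi fun _ : Fin N => μ).real (badSet μ u Q N (ε / 2)) ≤ κ) :
    (Measure.pi fun _ : Fin m => μ).real (badSet μ u Q m ε) ≤ δ := by
  refine reduction_limit μ hδ.le _ (hmeas _ _) fun κ hκ N0 => ?_
  obtain ⟨N, hN, hle⟩ := hGC κ hκ (max N0 1)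
  have hNpos : 0 < N := lt_of_lt_of_le one_pos (le_trans (le_max_right _ _) hN)
  haveI : Nonempty (Fin N) := ⟨⟨0, hNpos⟩⟩
  refine ⟨N, le_trans (le_max_left _ _) hN, _, hmeas _ _, hle, fun s hs => ?_⟩
  have h1 := levels_finite (Z := Fin N) hm hd hH hB (half_pos hε) hδ hδ1
    (fun (x : Q) z => u x (s z)) (fun x z => hu _ _) (fun i k hk ψ => by
      refine le_trans ?_ (hg i k hk (s ∘ ψ))
      norm_cast
      refine Set.ncard_le_ncard ?_ (Set.toFinite _)
      rintro _ ⟨x, rfl⟩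
      exact ⟨x, rfl⟩) hE
  rw [Fintype.card_fin] at h1
  refine le_trans ?_ h1
  norm_cast
  refine Set.ncard_le_ncard ?_ (Set.toFinite _)
  rintro φ ⟨x, hx, hlt⟩
  refine ⟨⟨x, hx⟩, ?_⟩
  simp only [badSet, Set.mem_ofPred_eq, not_exists, not_and, not_lt] at hs
  have h2 := hs x hx
  simp only [Function.comp] at hlt
  have h3 := abs_sub_le ((∑ j, (u x (s (φ j)) : ℝ)) / m) ((∑ z, (u x (s z) : ℝ)) / N)
    (∫ z, (u x z : ℝ) ∂μ)
  push_cast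
  linarith

theorem badSet_meas {Ω X : Type*} [MeasurableSpace Ω] (μ : Measure Ω)
    (u : X → Ω → ℕ) (hmeas : ∀ x, Measurable fun z => (u x z : ℝ))
    (Q : Set X) (hQ : Q.Countable) (n : ℕ) (t : ℝ) : MeasurableSet (badSet μ u Q n t) := by
  have : badSet μ u Q n t = ⋃ x ∈ Q, {s : Fin n → Ω |
      t < |(∑ j, (u x (s j) : ℝ)) / n - ∫ z, (u x z : ℝ) ∂μ|} := by
    ext s; simp [badSet]
  rw [this]
  refine MeasurableSet.biUnion hQ fun x _ => ?_
  refine measurableSet_lt measurable_const ?_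
  have h1 : Measurable fun s : Fin n → Ω => ∑ j, (u x (s j) : ℝ) :=
    Finset.measurable_sum _ fun j _ => (hmeas x).comp (measurable_pi_apply j)
  exact ((h1.div_const _).sub_const _).abs

theorem vc_finset {Ω X : Type*} [MeasurableSpace Ω] (μ : Measure Ω) [IsProbabilityMeasure μ]
    {m d H : ℕ} {B ε δ : ℝ} (hm : 0 < m) (hd : 1 ≤ d) (hH : 1 ≤ H) (hB : 1 ≤ B) (hε : 0 < ε)
    (hδ : 0 < δ) (hδ1 : δ ≤ 1) (u : X → Ω → ℕ) (hu : ∀ x z, u x z ≤ H)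
    (hmeas : ∀ x, Measurable fun z => (u x z : ℝ))
    (hg : ∀ i, ∀ k ≥ 1, ∀ ψ : Fin k → Ω,
      ((Set.range fun x => fun j => decide (i < u x (ψ j))).ncard : ℝ) ≤ (B * k) ^ d)
    (hE : 2 * d * Real.log (6 * B * d) + Real.log (8 * H / δ) ≤ m * (ε / 2 / H) ^ 2 / 1152)
    (Q : Finset X) :
    (Measure.pi fun _ : Fin m => μ).real (badSet μ u Q m ε) ≤ δ := by
  refine vc_prob μ hm hd hH hB hε hδ hδ1 u hu hg hE Q
    (badSet_meas μ u hmeas Q Q.countable_toSet) fun κ hκ N0 => ?_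
  have hlim : Filter.Tendsto (fun N : ℕ => Q.card * ((H:ℝ) ^ 2 / ((ε/2) ^ 2) / N)) Filter.atTop (nhds 0) := by
    simpa using (tendsto_const_div_atTop_nhds_zero_nat ((H:ℝ) ^ 2 / ((ε/2) ^ 2))).const_mul (Q.card : ℝ)
  obtain ⟨N, hN, hN1, hN0⟩ := ((hlim.eventually (gt_mem_nhds hκ)).and
    ((Filter.eventually_ge_atTop 1).and (Filter.eventually_ge_atTop N0))).exists
  refine ⟨N, hN0, le_trans ?_ hN.le⟩
  have : badSet μ u Q N (ε/2) = ⋃ x ∈ Q, {s : Fin N → Ω |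
      ε/2 < |(∑ j, (u x (s j) : ℝ)) / N - ∫ z, (u x z : ℝ) ∂μ|} := by
    ext s; simp [badSet]
  rw [this]
  refine (measureReal_biUnion_finset_le _ _).trans ?_
  refine (Finset.sum_le_card_nsmul _ _ _ fun x _ => lln μ (fun z => (u x z : ℝ)) (hmeas x)
    (K := H) (fun z => by positivity) (fun z => by exact_mod_cast hu x z) hN1 (half_pos hε)).trans ?_
  rw [nsmul_eq_mul, div_div]

theorem vc_countable {Ω X : Type*} [MeasurableSpace Ω] (μ : Measure Ω) [IsProbabilityMeasure μ]
    {m d H : ℕ} {B ε δ : ℝ} (hm : 0 < m) (hd : 1 ≤ d) (hH : 1 ≤ H) (hB : 1 ≤ B) (hε : 0 < ε)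
    (hδ : 0 < δ) (hδ1 : δ ≤ 1) (u : X → Ω → ℕ) (hu : ∀ x z, u x z ≤ H)
    (hmeas : ∀ x, Measurable fun z => (u x z : ℝ))
    (hg : ∀ i, ∀ k ≥ 1, ∀ ψ : Fin k → Ω,
      ((Set.range fun x => fun j => decide (i < u x (ψ j))).ncard : ℝ) ≤ (B * k) ^ d)
    (hE : 2 * d * Real.log (6 * B * d) + Real.log (8 * H / δ) ≤ m * (ε / 2 / H) ^ 2 / 1152)
    (Q : Set X) (hQ : Q.Countable) :
    (Measure.pi fun _ : Fin m => μ) (badSet μ u Q m ε) ≤ ENNReal.ofReal δ := by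
  classical
  rcases Q.eq_empty_or_nonempty with rfl | hne
  · simp [badSet]
  obtain ⟨f, rfl⟩ := hQ.exists_eq_range hne
  let S : ℕ → Set (Fin m → Ω) := fun k => badSet μ u ((Finset.range k).image f : Finset X) m ε
  have hS : badSet μ u (Set.range f) m ε = ⋃ k, S k := by
    ext s
    simp only [S, badSet, Set.mem_range, Set.mem_iUnion, Set.mem_ofPred_eq, Finset.coe_image,
      Set.mem_image, Finset.coe_range, Set.mem_Iio]
    constructor
    · rintro ⟨_, ⟨k, rfl⟩, h⟩; exact ⟨k+1, f k, ⟨k, by omega, rfl⟩, h⟩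
    · rintro ⟨k, _, ⟨j, _, rfl⟩, h⟩; exact ⟨f j, ⟨j, rfl⟩, h⟩
  have hmono : Monotone S := by
    intro a b hab s hs
    obtain ⟨x, hx, h⟩ := hs
    refine ⟨x, ?_, h⟩
    exact Finset.image_subset_image (Finset.range_mono hab) hx
  rw [hS, hmono.measure_iUnion]
  refine iSup_le fun k => ?_
  rw [← ENNReal.toReal_le_toReal (measure_ne_top _ _) ENNReal.ofReal_ne_top, ENNReal.toReal_ofReal hδ.le]
  exact vc_finset μ hm hd hH hB hε hδ hδ1 u hu hmeas hg hE _

/-- Sequential avoidance. -/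
theorem seq_avoid {Y : Type*} [MeasurableSpace Y] (ν : Measure Y) [IsProbabilityMeasure ν]
    (κ : ENNReal) (M : ℕ) : ∀ (G : List Y → Set Y), (∀ l, MeasurableSet (G l)) → (∀ l, ν (G l) ≤ κ) →
    ∀ S : Set (Fin M → Y), MeasurableSet S → M * κ < (Measure.pi fun _ : Fin M => ν) S →
    ∃ s ∈ S, ∀ c : Fin M, s c ∉ G ((List.ofFn s).take c) := by
  induction M with
  | zero =>
    intro G _ _ S _ h
    have : S.Nonempty := by
      by_contra hn
      rw [Set.not_nonempty_iff_eq_empty] at hn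
      simp [hn] at h
    obtain ⟨s, hs⟩ := this
    exact ⟨s, hs, fun c => c.elim0⟩
  | succ M ih =>
    intro G hG hν S hS h
    have hp := measurePreserving_piFinSuccAbove (fun _ : Fin (M+1) => ν) 0
    let e := MeasurableEquiv.piFinSuccAbove (fun _ : Fin (M+1) => Y) 0
    have hS' : MeasurableSet (e.symm ⁻¹' S) := e.symm.measurable hS
    have h1 : (Measure.pi fun _ : Fin (M+1) => ν) S =
        (ν.prod (Measure.pi fun _ : Fin M => ν)) (e.symm ⁻¹' S) := by
      have h2 : (Measure.pi fun _ : Fin (M+1) => ν) (e ⁻¹' (e.symm ⁻¹' S)) =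
        (ν.prod (Measure.pi fun _ : Fin M => ν)) (e.symm ⁻¹' S) :=
        hp.measure_preimage hS'.nullMeasurableSet
      rw [← h2, ← Set.preimage_comp]
      congr 1
      ext s; simp
    rw [h1, Measure.prod_apply hS'] at h
    have h2 : ∃ y, y ∉ G [] ∧ M * κ < (Measure.pi fun _ : Fin M => ν) (Prod.mk y ⁻¹' (e.symm ⁻¹' S)) := by
      by_contra hcon
      push Not at hcon
      refine absurd h (not_lt.2 ?_)
      calc ∫⁻ y, (Measure.pi fun _ : Fin M => ν) (Prod.mk y ⁻¹' (e.symm ⁻¹' S)) ∂ν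
          ≤ ∫⁻ y, ((G []).indicator (fun _ => 1) y + M * κ) ∂ν := by
            refine lintegral_mono fun y => ?_
            by_cases hy : y ∈ G []
            · simp only [Set.indicator_of_mem hy]
              exact prob_le_one.trans le_self_add
            · simp only [Set.indicator_of_notMem hy, zero_add]
              exact hcon y hy
        _ = ν (G []) + M * κ := by
            rw [lintegral_add_right _ measurable_const, lintegral_indicator_const (hG _)]
            simp
        _ ≤ κ + M * κ := by gcongr; exact hν _
        _ = (M + 1 : ℕ) * κ := by push_cast; ring
    obtain ⟨y, hy, hlt⟩ := h2
    obtain ⟨s, hs, hc⟩ := ih (fun l => G (y :: l)) (fun l => hG _) (fun l => hν _)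
      (Prod.mk y ⁻¹' (e.symm ⁻¹' S)) (measurable_prodMk_left hS') hlt
    refine ⟨Fin.cons y s, ?_, ?_⟩
    · have : e.symm (y, s) = Fin.cons y s := by
        simp [e, MeasurableEquiv.piFinSuccAbove, Fin.insertNthEquiv]
      rw [← this]; exact hs
    · intro c
      refine Fin.cases ?_ (fun c => ?_) c
      · simpa using hy
      · simpa [List.ofFn_succ] using hc c

theorem mp_uncurry {Ω : Type*} [MeasurableSpace Ω] (μ : Measure Ω) [IsProbabilityMeasure μ]
    (M n : ℕ) :
    MeasurePreserving (fun (w : Fin M → Fin n → Ω) (q : Fin M × Fin n) => w q.1 q.2)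
      (Measure.pi fun _ => Measure.pi fun _ => μ) (Measure.pi fun _ => μ) := by
  have hmeas : Measurable (fun (w : Fin M → Fin n → Ω) (q : Fin M × Fin n) => w q.1 q.2) :=
    measurable_pi_lambda _ fun q => (measurable_pi_apply q.2).comp (measurable_pi_apply q.1)
  refine ⟨hmeas, ?_⟩
  symm
  refine Measure.pi_eq fun A hA => ?_
  rw [Measure.map_apply hmeas (MeasurableSet.univ_pi hA)]
  have : (fun (w : Fin M → Fin n → Ω) (q : Fin M × Fin n) => w q.1 q.2) ⁻¹' (Set.univ.pi A) =
      Set.univ.pi fun i => Set.univ.pi fun j => A (i, j) := by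
    ext w
    simp [Set.mem_univ_pi]
  rw [this, Measure.pi_pi]
  simp only [Measure.pi_pi, Fintype.prod_prod_type]

theorem mp_chunks {Ω : Type*} [MeasurableSpace Ω] (μ : Measure Ω) [IsProbabilityMeasure μ]
    (M n : ℕ) :
    MeasurePreserving (fun (w : Fin M → Fin n → Ω) (i : Fin (M * n)) =>
        w (finProdFinEquiv.symm i).1 (finProdFinEquiv.symm i).2)
      (Measure.pi fun _ => Measure.pi fun _ => μ) (Measure.pi fun _ => μ) :=
  (pi_precomp μ (finProdFinEquiv (m := M) (n := n)).symm (Equiv.injective _)).comp (mp_uncurry μ M n)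

end GDPW

namespace GDPW

theorem count_jumps (r : ℕ → ℕ) (hr : Monotone r) (M : ℕ) :
    ((Finset.range M).filter fun c => r c ≠ r (c+1)).card + r 0 ≤ r M := by
  induction M with
  | zero => simp
  | succ M ih =>
    rw [Finset.range_add_one, Finset.filter_insert]
    have := hr (Nat.le_succ M)
    split_ifs with h
    · rw [Finset.card_insert_of_notMem (by simp)]
      simp only [Nat.succ_eq_add_one] at this
      omega
    · push Not at h
      omega

theorem mem_take_ofFn {Y : Type*} {M : ℕ} (s : Fin M → Y) (c : ℕ) (w : Y) :
    w ∈ (List.ofFn s).take c ↔ ∃ i : Fin M, (i : ℕ) < c ∧ s i = w := by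
  rw [List.mem_take_iff_getElem]
  constructor
  · rintro ⟨i, hi, rfl⟩
    simp only [List.length_ofFn, lt_inf_iff] at hi
    exact ⟨⟨i, hi.2⟩, hi.1, by simp⟩
  · rintro ⟨i, hi, rfl⟩
    exact ⟨i, by simp [hi], by simp⟩

open MvPolynomial

theorem exists_Q {d : ℕ} (P : (Fin d → ℝ) → ℝ) (T : Set (MvPolynomial (Fin d) ℝ)) :
    ∃ Q : Set (Fin d → ℝ), Q.Countable ∧ (∀ q ∈ Q, ∀ f ∈ T, eval q f = 0) ∧
      ∀ x, (∀ f ∈ T, eval x f = 0) → ∀ U ∈ nhds x, ∀ t > 0, ∃ q ∈ Q, q ∈ U ∧ |P q - P x| < t := by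
  let A : Set ((Fin d → ℝ) × ℝ) := (fun x => (x, P x)) '' {x | ∀ f ∈ T, eval x f = 0}
  obtain ⟨t, htA, htc, htd⟩ := (TopologicalSpace.IsSeparable.of_separableSpace A).exists_countable_dense_subset
  refine ⟨Prod.fst '' t, htc.image _, ?_, ?_⟩
  · rintro _ ⟨a, ha, rfl⟩
    obtain ⟨x, hx, rfl⟩ := htA ha
    exact hx
  · intro x hx U hU τ hτ
    have hxA : (x, P x) ∈ closure t := htd ⟨x, hx, rfl⟩
    rw [mem_closure_iff_nhds] at hxA
    obtain ⟨a, ha1, ha2⟩ := hxA (U ×ˢ Metric.ball (P x) τ)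
      (prod_mem_nhds hU (Metric.ball_mem_nhds _ hτ))
    obtain ⟨y, hy, rfl⟩ := htA ha2
    refine ⟨y, ⟨_, ha2, rfl⟩, ha1.1, ?_⟩
    have := ha1.2
    rwa [Metric.mem_ball, Real.dist_eq] at this

/-- All polynomials attached to the instances in a list of chunks. -/
def Fset {Ω : Type*} {d H n : ℕ} (h : Ω → Fin H → MvPolynomial (Fin d) ℝ) (l : List (Fin n → Ω)) :
    Set (MvPolynomial (Fin d) ℝ) := {f | ∃ w ∈ l, ∃ j k, h (w j) k = f}

theorem Fset_finite {Ω : Type*} {d H n : ℕ} (h : Ω → Fin H → MvPolynomial (Fin d) ℝ)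
    (l : List (Fin n → Ω)) : (Fset h l).Finite := by
  have : Fset h l = ⋃ w ∈ {w | w ∈ l}, Set.range fun q : Fin n × Fin H => h (w q.1) q.2 := by
    ext f; simp [Fset]
  rw [this]
  exact Set.Finite.biUnion l.finite_toSet fun w _ => Set.finite_range _

theorem det_chunk {Ω : Type*} {d H n : ℕ} (h : Ω → Fin H → MvPolynomial (Fin d) ℝ)
    (u : (Fin d → ℝ) → Ω → ℕ)
    (hsig : ∀ x y z, (∀ j, 0 ≤ eval x (h z j) ↔ 0 ≤ eval y (h z j)) → u x z = u y z)
    (P : (Fin d → ℝ) → ℝ) (T : Set (MvPolynomial (Fin d) ℝ)) (Q : Set (Fin d → ℝ))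
    (hQ0 : ∀ q ∈ Q, ∀ f ∈ T, eval q f = 0) (x : Fin d → ℝ)
    (hQ : ∀ U ∈ nhds x, ∀ t > 0, ∃ q ∈ Q, q ∈ U ∧ |P q - P x| < t) {t : ℝ} (ht : 0 < t)
    (w : Fin n → Ω) (hw : ∀ j k, eval x (h (w j) k) = 0 → h (w j) k ∈ Submodule.span ℝ T)
    (hav : ∀ q ∈ Q, |(∑ j, (u q (w j) : ℝ)) / n - P q| ≤ t) :
    |(∑ j, (u x (w j) : ℝ)) / n - P x| ≤ 2 * t := by
  have hcont : ∀ f : MvPolynomial (Fin d) ℝ, Continuous fun y => eval y f := fun f =>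
    MvPolynomial.continuous_eval f
  have hU : ∀ᶠ y in nhds x, ∀ j k, eval x (h (w j) k) ≠ 0 →
      (0 ≤ eval x (h (w j) k) ↔ 0 ≤ eval y (h (w j) k)) := by
    rw [Filter.eventually_all]; intro j
    rw [Filter.eventually_all]; intro k
    rcases lt_trichotomy (eval x (h (w j) k)) 0 with hlt | heq | hgt
    · filter_upwards [(hcont (h (w j) k)).continuousAt.eventually (gt_mem_nhds hlt)] with y hy _
      exact ⟨fun h1 => absurd h1 (not_le.2 hlt), fun h1 => absurd h1 (not_le.2 hy)⟩
    · exact Filter.Eventually.of_forall fun y hy => absurd heq hy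
    · filter_upwards [(hcont (h (w j) k)).continuousAt.eventually (lt_mem_nhds hgt)] with y hy _
      exact ⟨fun _ => hy.le, fun _ => hgt.le⟩
  obtain ⟨q, hq, hqU, hqP⟩ := hQ _ hU t ht
  have hz : ∀ f ∈ Submodule.span ℝ T, eval q f = 0 := by
    intro f hf
    induction hf using Submodule.span_induction with
    | mem f hf => exact hQ0 q hq f hf
    | zero => simp
    | add f g _ _ hf hg => simp [hf, hg]
    | smul a f _ hf => simp [smul_eval, hf]
  have heq : ∀ j, u x (w j) = u q (w j) := by
    intro j
    refine hsig _ _ _ fun k => ?_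
    by_cases h0 : eval x (h (w j) k) = 0
    · rw [h0, hz _ (hw j k h0)]
    · exact hqU j k h0
  simp only [heq]
  have h1 := hav q hq
  have h2 := abs_sub_le ((∑ j, (u q (w j) : ℝ)) / n) (P q) (P x)
  linarith

theorem det_gc {Ω : Type*} {d H n M D : ℕ} (hn : 0 < n) (h : Ω → Fin H → MvPolynomial (Fin d) ℝ)
    (hD : ∀ z j, (h z j).totalDegree ≤ D)
    (u : (Fin d → ℝ) → Ω → ℕ) (hu : ∀ x z, u x z ≤ H)
    (hsig : ∀ x y z, (∀ j, 0 ≤ eval x (h z j) ↔ 0 ≤ eval y (h z j)) → u x z = u y z)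
    (P : (Fin d → ℝ) → ℝ) (hP0 : ∀ x, 0 ≤ P x) (hP1 : ∀ x, P x ≤ H)
    (QT : Set (MvPolynomial (Fin d) ℝ) → Set (Fin d → ℝ))
    (hQ0 : ∀ T, ∀ q ∈ QT T, ∀ f ∈ T, eval q f = 0)
    (hQ : ∀ T x, (∀ f ∈ T, eval x f = 0) → ∀ U ∈ nhds x, ∀ t > 0, ∃ q ∈ QT T, q ∈ U ∧ |P q - P x| < t)
    {t : ℝ} (ht : 0 < t) (s : Fin M → Fin n → Ω)
    (hav : ∀ c : Fin M, ∀ T ⊆ Fset h ((List.ofFn s).take c), ∀ q ∈ QT T,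
      |(∑ j, (u q (s c j) : ℝ)) / n - P q| ≤ t) (x : Fin d → ℝ) :
    ∑ c : Fin M, |(∑ j, (u x (s c j) : ℝ)) / n - P x| ≤
      M * (2 * t) + Module.finrank ℝ (restrictTotalDegree (Fin d) ℝ D) * H := by
  classical
  have hn' : (0:ℝ) < n := by exact_mod_cast hn
  let T : ℕ → Set (MvPolynomial (Fin d) ℝ) := fun c =>
    {f | f ∈ Fset h ((List.ofFn s).take c) ∧ eval x f = 0}
  let V : ℕ → Submodule ℝ (MvPolynomial (Fin d) ℝ) := fun c => Submodule.span ℝ (T c)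
  have hTmono : Monotone T := by
    intro a b hab f hf
    obtain ⟨⟨w, hw, j, k, rfl⟩, h0⟩ := hf
    refine ⟨⟨w, ?_, j, k, rfl⟩, h0⟩
    rw [mem_take_ofFn] at hw ⊢
    obtain ⟨i, hi, rfl⟩ := hw
    exact ⟨i, by omega, rfl⟩
  have hVmono : Monotone V := fun a b hab => Submodule.span_mono (hTmono hab)
  have hVle : ∀ c, V c ≤ restrictTotalDegree (Fin d) ℝ D := by
    intro c
    refine Submodule.span_le.2 ?_
    rintro f ⟨⟨w, hw, j, k, rfl⟩, h0⟩
    exact (mem_restrictTotalDegree _ _ _).2 (hD _ _)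
  have hfd : ∀ c, FiniteDimensional ℝ (V c) := fun c => Submodule.finiteDimensional_of_le (hVle c)
  let r : ℕ → ℕ := fun c => Module.finrank ℝ (V c)
  have hrmono : Monotone r := fun a b hab => by
    have := hfd b
    exact Submodule.finrank_mono (hVmono hab)
  have hcount := count_jumps r hrmono M
  have hrM : r M ≤ Module.finrank ℝ (restrictTotalDegree (Fin d) ℝ D) :=
    Submodule.finrank_mono (hVle M)
  have hgood : ∀ c : Fin M, r c = r (c+1) → |(∑ j, (u x (s c j) : ℝ)) / n - P x| ≤ 2 * t := by
    intro c hc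
    have hV : V c = V (c+1) := by
      have := hfd (c+1)
      exact Submodule.eq_of_le_of_finrank_eq (hVmono (Nat.le_succ _)) hc
    refine det_chunk h u hsig P (T c) (QT (T c)) (hQ0 _) x (hQ _ x fun f hf => hf.2) ht (s c) ?_ ?_
    · intro j k h0
      change _ ∈ V c
      rw [hV]
      refine Submodule.subset_span ⟨⟨s c, ?_, j, k, rfl⟩, h0⟩
      rw [mem_take_ofFn]
      exact ⟨c, Nat.lt_succ_self _, rfl⟩
    · exact hav c (T c) fun f hf => hf.1
  have hall : ∀ c : Fin M, |(∑ j, (u x (s c j) : ℝ)) / n - P x| ≤ H := by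
    intro c
    have h1 : 0 ≤ (∑ j, (u x (s c j) : ℝ)) / n := by positivity
    have h2 : (∑ j, (u x (s c j) : ℝ)) / n ≤ H := by
      rw [div_le_iff₀ hn']
      refine (Finset.sum_le_card_nsmul _ _ (H:ℝ) fun j _ => by exact_mod_cast hu _ _).trans (le_of_eq ?_)
      simp [mul_comm]
    rw [abs_le]
    have := hP0 x
    have := hP1 x
    constructor <;> linarith
  have hb : ∀ c : Fin M, |(∑ j, (u x (s c j) : ℝ)) / n - P x| ≤
      2 * t + (if r c ≠ r (c+1) then (H:ℝ) else 0) := by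
    intro c
    split_ifs with hc
    · have := hall c; linarith
    · push Not at hc
      have := hgood c hc; linarith
  refine (Finset.sum_le_sum fun c _ => hb c).trans ?_
  rw [Finset.sum_add_distrib]
  simp only [Finset.sum_const, Finset.card_univ, Fintype.card_fin, nsmul_eq_mul]
  refine add_le_add le_rfl ?_
  rw [Fin.sum_univ_eq_sum_range (fun c => if r c ≠ r (c+1) then (H:ℝ) else 0) M,
    ← Finset.sum_filter, Finset.sum_const, nsmul_eq_mul]
  refine mul_le_mul_of_nonneg_right ?_ (by positivity)
  exact_mod_cast (by omega : ((Finset.range M).filter fun c => r c ≠ r (c+1)).card ≤ _)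

theorem gc {Ω : Type*} [MeasurableSpace Ω] (μ : Measure Ω) [IsProbabilityMeasure μ]
    {d H D : ℕ} (hd : 1 ≤ d) (hH : 1 ≤ H) (h : Ω → Fin H → MvPolynomial (Fin d) ℝ)
    (hD : ∀ z j, (h z j).totalDegree ≤ D)
    (u : (Fin d → ℝ) → Ω → ℕ) (hu : ∀ x z, u x z ≤ H)
    (hmeas : ∀ x, Measurable fun z => (u x z : ℝ))
    (hsig : ∀ x y z, (∀ j, 0 ≤ eval x (h z j) ↔ 0 ≤ eval y (h z j)) → u x z = u y z)
    (hbad : ∀ n t, MeasurableSet (badSet μ u Set.univ n t)) {ε : ℝ} (hε : 0 < ε) :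
    ∀ κ > 0, ∀ N0 : ℕ, ∃ N ≥ N0,
      (Measure.pi fun _ : Fin N => μ).real (badSet μ u Set.univ N ε) ≤ κ := by
  classical
  have key : ∀ κ > 0, κ ≤ 1 → ∀ N0 : ℕ, ∃ N ≥ N0,
      (Measure.pi fun _ : Fin N => μ).real (badSet μ u Set.univ N ε) ≤ κ := by
    intro κ hκ hκ1 N0
    have hH' : (0:ℝ) < H := by exact_mod_cast hH
    set P : (Fin d → ℝ) → ℝ := fun x => ∫ z, (u x z : ℝ) ∂μ with hPdef
    have hP0 : ∀ x, 0 ≤ P x := fun x => integral_nonneg fun z => Nat.cast_nonneg _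
    have hP1 : ∀ x, P x ≤ H := by
      intro x
      have h1 : Integrable (fun z => (u x z : ℝ)) μ :=
        Integrable.of_bound (hmeas x).aestronglyMeasurable (H:ℝ) (Filter.Eventually.of_forall fun z => by
          rw [Real.norm_natCast]; exact_mod_cast hu x z)
      have := integral_mono h1 (integrable_const (H:ℝ)) (fun z => by
        simp only; exact_mod_cast hu x z)
      simpa using this
    set K := Module.finrank ℝ (restrictTotalDegree (Fin d) ℝ D)
    set t := ε / 4 with ht
    have ht0 : 0 < t := by positivity
    obtain ⟨M, hM⟩ := exists_nat_gt (max 1 (K * H / (ε/2)))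
    have hM1 : (1:ℝ) < M := lt_of_le_of_lt (le_max_left _ _) hM
    have hM2 : K * H < M * (ε / 2) := by
      have := lt_of_le_of_lt (le_max_right _ _) hM
      rwa [div_lt_iff₀ (by positivity)] at this
    have hMpos : 0 < M := by
      have : (0:ℝ) < M := by linarith
      exact_mod_cast this
    set κ' := κ / M with hκ'
    have hκ'0 : 0 < κ' := by positivity
    have hκ'1 : κ' ≤ 1 := (div_le_self hκ.le hM1.le).trans hκ1
    set B : ℝ := 2 * H * D + 1 with hB
    have hB1 : 1 ≤ B := by
      have : (0:ℝ) ≤ 2 * H * D := by positivity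
      linarith
    have hlim : Filter.Tendsto (fun n : ℕ => (n:ℝ) * ((t / 2 / H) ^ 2 / 1152)) Filter.atTop Filter.atTop :=
      tendsto_natCast_atTop_atTop.atTop_mul_const (by positivity)
    obtain ⟨n, hn1, hn2, hnN⟩ := ((hlim.eventually_ge_atTop
      (2 * d * Real.log (6 * B * d) + Real.log (8 * H / κ'))).and
      ((Filter.eventually_ge_atTop 1).and (Filter.eventually_ge_atTop N0))).exists
    have hn' : (0:ℝ) < n := by exact_mod_cast hn2
    refine ⟨M * n, hnN.trans (Nat.le_mul_of_pos_left _ hMpos), ?_⟩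
    choose QT hQc hQ0 hQ using exists_Q P
    let Q : List (Fin n → Ω) → Set (Fin d → ℝ) := fun l => ⋃ T ∈ {T | T ⊆ Fset h l}, QT T
    have hQcount : ∀ l, (Q l).Countable := fun l =>
      Set.Countable.biUnion (Fset_finite h l).finite_subsets.countable fun T _ => hQc T
    have hvc : ∀ l, (Measure.pi fun _ : Fin n => μ) (badSet μ u (Q l) n t) ≤ ENNReal.ofReal κ' := by
      intro l
      refine vc_countable μ hn2 hd hH hB1 ht0 hκ'0 hκ'1 u hu hmeas
        (fun i k hk ψ => growth hd h hD u hsig i k hk ψ) ?_ (Q l) (hQcount l)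
      rw [← mul_div_assoc] at hn1
      exact hn1
    by_contra hcon
    push Not at hcon
    let Φ : (Fin M → Fin n → Ω) → (Fin (M * n) → Ω) := fun w i =>
        w (finProdFinEquiv.symm i).1 (finProdFinEquiv.symm i).2
    have hΦ := mp_chunks μ M n
    have hlt : (M:ENNReal) * ENNReal.ofReal κ' <
        (Measure.pi fun _ : Fin M => Measure.pi fun _ : Fin n => μ)
          (Φ ⁻¹' badSet μ u Set.univ (M * n) ε) := by
      rw [hΦ.measure_preimage (hbad _ _).nullMeasurableSet]
      have : (M:ENNReal) * ENNReal.ofReal κ' = ENNReal.ofReal κ := by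
        rw [← ENNReal.ofReal_natCast, ← ENNReal.ofReal_mul (by positivity), hκ',
          mul_div_cancel₀ _ (by positivity)]
      rw [this, ← ofReal_measureReal (measure_ne_top _ _)]
      exact (ENNReal.ofReal_lt_ofReal_iff (hκ.trans hcon)).2 hcon
    obtain ⟨s, hs, hav⟩ := seq_avoid (Measure.pi fun _ : Fin n => μ) (ENNReal.ofReal κ') M
      (fun l => badSet μ u (Q l) n t) (fun l => badSet_meas μ u hmeas _ (hQcount l) _ _) hvc
      (Φ ⁻¹' badSet μ u Set.univ (M * n) ε) (hΦ.measurable (hbad _ _)) hlt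
    obtain ⟨x, -, hx⟩ := hs
    have hdet := det_gc hn2 h hD u hu hsig P hP0 hP1 QT hQ0 hQ ht0 s (by
      intro c T hT q hq
      have := hav c
      simp only [badSet, Set.mem_ofPred_eq, not_exists, not_and, not_lt] at this
      exact this q (Set.mem_biUnion (show T ∈ {T | T ⊆ Fset h ((List.ofFn s).take c)} from hT) hq)) x
    have hsum : ∑ i : Fin (M * n), (u x (Φ s i) : ℝ) = ∑ c : Fin M, ∑ j : Fin n, (u x (s c j) : ℝ) := by
      rw [← finProdFinEquiv.sum_comp, Fintype.sum_prod_type]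
      simp only [Φ, Equiv.symm_apply_apply]
    rw [hsum] at hx
    have hM0 : (0:ℝ) < M := by linarith
    have e1 : (∑ c : Fin M, ∑ j : Fin n, (u x (s c j) : ℝ)) / ((M * n : ℕ):ℝ) - P x =
        (∑ c : Fin M, ((∑ j, (u x (s c j) : ℝ)) / n - P x)) / M := by
      rw [Finset.sum_sub_distrib, ← Finset.sum_div]
      simp only [Finset.sum_const, Finset.card_univ, Fintype.card_fin, nsmul_eq_mul]
      push_cast
      field_simp
    change ε < |(∑ c : Fin M, ∑ j : Fin n, (u x (s c j) : ℝ)) / ((M * n : ℕ):ℝ) - P x| at hx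
    rw [e1, abs_div, abs_of_pos hM0, lt_div_iff₀ hM0] at hx
    have h2 := (Finset.abs_sum_le_sum_abs (fun c : Fin M => (∑ j, (u x (s c j) : ℝ)) / n - P x)
      Finset.univ).trans hdet
    have h3 : M * (2 * t) = M * (ε / 2) := by rw [ht]; ring
    rw [h3] at h2
    nlinarith
  intro κ hκ N0
  obtain ⟨N, hN, hle⟩ := key (min κ 1) (lt_min hκ one_pos) (min_le_right _ _) N0
  exact ⟨N, hN, hle.trans (min_le_left _ _)⟩

end GDPW

namespace GDPW

open MvPolynomial

theorem global_poly {d p Δ : ℕ} (f : EuclideanSpace ℝ (Fin d) → ℝ)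
    (g : Fin p → MvPolynomial (Fin d) ℝ) (hf : IsPWPolyWith p Δ f g)
    (hg : ∀ x : EuclideanSpace ℝ (Fin d), ∀ k, eval (fun j => x j) (g k) ≠ 0) :
    ∃ q : MvPolynomial (Fin d) ℝ, q.totalDegree ≤ Δ ∧ f = fun w => eval (fun j => w j) q := by
  obtain ⟨q, hq, h⟩ := hf.2 0 (hg 0)
  refine ⟨q, hq, funext fun w => h w ?_⟩
  have : {w : EuclideanSpace ℝ (Fin d) | ∀ k, eval (fun j => w j) (g k) ≠ 0} = Set.univ :=
    Set.eq_univ_of_forall hg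
  rw [this, connectedComponentIn_univ, PreconnectedSpace.connectedComponent_eq_univ]
  trivial

theorem gradient_poly {d : ℕ} (q : MvPolynomial (Fin d) ℝ) (y : EuclideanSpace ℝ (Fin d)) :
    gradient (fun w : EuclideanSpace ℝ (Fin d) => eval (fun j => w j) q) y =
      WithLp.toLp 2 (fun k => eval (fun j => y j) (pderiv k q)) := by
  refine HasGradientAt.gradient ?_
  rw [hasGradientAt_iff_hasFDerivAt]
  have h1 := hasFDerivAt_eval q (fun j => y j)
  have h2 : HasFDerivAt (fun w : EuclideanSpace ℝ (Fin d) => (fun j => w j : Fin d → ℝ))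
      ((PiLp.continuousLinearEquiv 2 ℝ (fun _ : Fin d => ℝ)) : EuclideanSpace ℝ (Fin d) →L[ℝ] (Fin d → ℝ)) y :=
    (PiLp.continuousLinearEquiv 2 ℝ (fun _ : Fin d => ℝ)).hasFDerivAt
  refine (h1.comp y h2).congr_fderiv ?_
  ext v
  simp [PiLp.inner_apply, mul_comm]

theorem totalDegree_bind {d n : ℕ} (g : Fin d → MvPolynomial (Fin d) ℝ)
    (hg : ∀ j, (g j).totalDegree ≤ n) (p : MvPolynomial (Fin d) ℝ) :
    (bind₁ g p).totalDegree ≤ p.totalDegree * n := by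
  conv_lhs => rw [p.as_sum, map_sum]
  refine totalDegree_finsetSum_le fun m hm => ?_
  rw [bind₁_monomial]
  refine (totalDegree_mul _ _).trans ?_
  rw [totalDegree_C, zero_add]
  refine (totalDegree_finsetProd _ _).trans ?_
  have h1 : ∀ i ∈ m.support, (g i ^ m i).totalDegree ≤ m i * n := fun i _ =>
    (totalDegree_pow _ _).trans (Nat.mul_le_mul_left _ (hg i))
  refine (Finset.sum_le_sum h1).trans ?_
  rw [← Finset.sum_mul]
  refine Nat.mul_le_mul_right _ ?_
  exact le_totalDegree hm

/-- Polynomials expressing the gradient-descent iterates. -/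
noncomputable def itp {d : ℕ} (η : ℝ) (q : MvPolynomial (Fin d) ℝ) :
    ℕ → Fin d → MvPolynomial (Fin d) ℝ
  | 0 => fun j => X j
  | i + 1 => fun j => itp η q i j - C η * bind₁ (itp η q i) (pderiv j q)

theorem eval_bind {d : ℕ} (x : Fin d → ℝ) (g : Fin d → MvPolynomial (Fin d) ℝ)
    (p : MvPolynomial (Fin d) ℝ) : eval x (bind₁ g p) = eval (fun j => eval x (g j)) p := by
  rw [← coe_aeval_eq_eval, ← coe_aeval_eq_eval]
  simp only [RingHom.coe_coe, aeval_bind₁]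

theorem eval_itp {d : ℕ} (η : ℝ) (q : MvPolynomial (Fin d) ℝ) (x : EuclideanSpace ℝ (Fin d)) (i : ℕ) :
    (fun j => eval (fun j => x j) (itp η q i j)) =
      fun j => gdIter (fun w : EuclideanSpace ℝ (Fin d) => eval (fun j => w j) q) x η i j := by
  induction i with
  | zero => funext j; simp [itp, gdIter]
  | succ i ih =>
    funext j
    have := congrFun ih j
    simp only at this
    simp only [itp, gdIter, map_sub, map_mul, eval_C, eval_bind, ih, gradient_poly, this]
    simp

theorem itp_degree {d Δ : ℕ} (hΔ : 1 ≤ Δ) (η : ℝ) (q : MvPolynomial (Fin d) ℝ)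
    (hq : q.totalDegree ≤ Δ) (i : ℕ) (j : Fin d) : (itp η q i j).totalDegree ≤ Δ ^ i := by
  induction i generalizing j with
  | zero => simp [itp]
  | succ i ih =>
    simp only [itp]
    refine (totalDegree_sub _ _).trans (max_le ?_ ?_)
    · exact (ih j).trans (Nat.pow_le_pow_right hΔ (Nat.le_succ i))
    · refine (totalDegree_mul _ _).trans ?_
      rw [totalDegree_C, zero_add]
      refine (totalDegree_bind _ ih _).trans ?_
      rw [pow_succ']
      exact Nat.mul_le_mul_right _ ((totalDegree_pderiv_le j q).trans hq)

/-- Polynomial whose sign decides the stopping test at iterate `i`. -/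
noncomputable def hp {d : ℕ} (θ η : ℝ) (q : MvPolynomial (Fin d) ℝ) (i : ℕ) : MvPolynomial (Fin d) ℝ :=
  (∑ k, (bind₁ (itp η q i) (pderiv k q)) ^ 2) - C (θ ^ 2)

theorem hp_degree {d Δ : ℕ} (hΔ : 1 ≤ Δ) (θ η : ℝ) (q : MvPolynomial (Fin d) ℝ)
    (hq : q.totalDegree ≤ Δ) (i H : ℕ) (hi : i < H) : (hp θ η q i).totalDegree ≤ 2 * Δ ^ H := by
  refine (totalDegree_sub _ _).trans (max_le ?_ (by rw [totalDegree_C]; exact Nat.zero_le _))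
  refine totalDegree_finsetSum_le fun k _ => ?_
  refine (totalDegree_pow _ _).trans (Nat.mul_le_mul_left _ ?_)
  refine (totalDegree_bind _ (itp_degree hΔ η q hq i) _).trans ?_
  calc (pderiv k q).totalDegree * Δ ^ i ≤ Δ * Δ ^ i :=
        Nat.mul_le_mul_right _ ((totalDegree_pderiv_le k q).trans hq)
    _ = Δ ^ (i+1) := (pow_succ' _ _).symm
    _ ≤ Δ ^ H := Nat.pow_le_pow_right hΔ hi

theorem hp_sign {d : ℕ} {θ : ℝ} (hθ : 0 < θ) (η : ℝ) (q : MvPolynomial (Fin d) ℝ)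
    (x : EuclideanSpace ℝ (Fin d)) (i : ℕ) :
    ‖gradient (fun w : EuclideanSpace ℝ (Fin d) => eval (fun j => w j) q)
      (gdIter (fun w : EuclideanSpace ℝ (Fin d) => eval (fun j => w j) q) x η i)‖ < θ ↔
      ¬ 0 ≤ eval (fun j => x j) (hp θ η q i) := by
  rw [← sq_lt_sq₀ (norm_nonneg _) hθ.le, EuclideanSpace.norm_sq_eq, gradient_poly]
  simp only [hp, map_sub, map_sum, map_pow, eval_C, eval_bind, eval_itp, Real.norm_eq_abs, sq_abs]
  rw [not_le, sub_neg]

theorem gdCost_le {d H : ℕ} {θ : ℝ} (f : EuclideanSpace ℝ (Fin d) → ℝ)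
    (x : EuclideanSpace ℝ (Fin d)) (η : ℝ) : gdCost H θ f x η ≤ H :=
  Nat.sInf_le (Or.inr rfl)

theorem gdCost_sign {d H : ℕ} {θ : ℝ} (hθ : 0 < θ) (η : ℝ) (q : MvPolynomial (Fin d) ℝ)
    (x y : EuclideanSpace ℝ (Fin d))
    (h : ∀ j : Fin H, 0 ≤ eval (fun j => x j) (hp θ η q j) ↔ 0 ≤ eval (fun j => y j) (hp θ η q j)) :
    gdCost H θ (fun w : EuclideanSpace ℝ (Fin d) => eval (fun j => w j) q) x η =
    gdCost H θ (fun w : EuclideanSpace ℝ (Fin d) => eval (fun j => w j) q) y η := by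
  unfold gdCost
  congr 2
  ext i
  simp only [Set.mem_ofPred_eq, hp_sign hθ]
  constructor
  · rintro ⟨h1, h2, h3⟩
    exact ⟨h1, h2, by rwa [← h ⟨i - 1, by omega⟩]⟩
  · rintro ⟨h1, h2, h3⟩
    exact ⟨h1, h2, by rwa [h ⟨i - 1, by omega⟩]⟩

theorem numeric {d H p Δ : ℕ} (hd : 1 ≤ d) (hH : 1 ≤ H) (hp : 1 ≤ p) (hΔ : 1 ≤ Δ) {ε δ : ℝ}
    (hε : 0 < ε) (hδ : 0 < δ) (hδ1 : δ < 1) {m : ℝ}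
    (hm : 92160 * ((H : ℝ) ^ 2 / ε ^ 2 *
            ((d : ℝ) * (H : ℝ) * Real.log (2 * p * d * Δ) + Real.log (1 / δ))) ≤ m) :
    0 < m ∧ 2 * d * Real.log (6 * (2 * H * ((2 * Δ ^ H : ℕ) : ℝ) + 1) * d) + Real.log (8 * H / δ) ≤
      m * (ε / 2 / H) ^ 2 / 1152 := by
  have hd' : (1:ℝ) ≤ d := by exact_mod_cast hd
  have hH' : (1:ℝ) ≤ H := by exact_mod_cast hH
  have hp' : (1:ℝ) ≤ p := by exact_mod_cast hp
  have hΔ' : (1:ℝ) ≤ Δ := by exact_mod_cast hΔ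
  have hd0 : (0:ℝ) < d := by linarith
  have hH0 : (0:ℝ) < H := by linarith
  have hΔ0 : (0:ℝ) < Δ := by linarith
  set Λ := Real.log (2 * p * d * Δ) with hΛ
  have hpd : (1:ℝ) ≤ p * d := one_le_mul_of_one_le_of_one_le hp' hd'
  have hpΔ : (1:ℝ) ≤ p * Δ := one_le_mul_of_one_le_of_one_le hp' hΔ'
  have hpdΔ : (1:ℝ) ≤ p * d * Δ := one_le_mul_of_one_le_of_one_le hpd hΔ'
  have hΛ2 : Real.log 2 ≤ Λ := Real.log_le_log (by norm_num) (by nlinarith)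
  have hΛd : Real.log d ≤ Λ := Real.log_le_log hd0 (by nlinarith)
  have hΛΔ : Real.log Δ ≤ Λ := Real.log_le_log hΔ0 (by nlinarith)
  have hl2 : 0 < Real.log 2 := Real.log_pos (by norm_num)
  have hΛ0 : 0 < Λ := by linarith
  have hHΛ : Λ ≤ H * Λ := by nlinarith
  have hdH : H * Λ ≤ d * H * Λ := by nlinarith [mul_pos hH0 hΛ0]
  have hlogH : Real.log H ≤ H * Λ := by
    have h1 : (H:ℝ) ≤ 2 ^ H := by exact_mod_cast Nat.lt_two_pow_self.le
    have h2 := Real.log_le_log hH0 h1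
    rw [Real.log_pow] at h2
    nlinarith
  have hlog1 : 0 < Real.log (1/δ) := Real.log_pos (by rw [lt_div_iff₀ hδ]; linarith)
  have hpow : (1:ℝ) ≤ Δ ^ H := one_le_pow₀ hΔ'
  have hlogB : Real.log (6 * (2 * H * ((2 * Δ ^ H : ℕ) : ℝ) + 1) * d) ≤ 8 * (H * Λ) := by
    have h1 : 6 * (2 * H * ((2 * Δ ^ H : ℕ) : ℝ) + 1) * d ≤ 2 ^ 5 * (H * (d * Δ ^ H)) := by
      push_cast
      have h2 : (1:ℝ) ≤ H * Δ ^ H := one_le_mul_of_one_le_of_one_le hH' hpow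
      have h3 : 6 * (2 * H * (2 * Δ ^ H) + 1) ≤ 32 * (H * (Δ:ℝ) ^ H) := by nlinarith
      have := mul_le_mul_of_nonneg_right h3 hd0.le
      nlinarith
    refine (Real.log_le_log (by positivity) h1).trans ?_
    rw [Real.log_mul (by positivity) (by positivity), Real.log_mul (by positivity) (by positivity),
      Real.log_mul (by positivity) (by positivity), Real.log_pow, Real.log_pow]
    have : H * Real.log Δ ≤ H * Λ := mul_le_mul_of_nonneg_left hΛΔ hH0.le
    push_cast
    linarith
  have hlog8 : Real.log (8 * H / δ) ≤ 4 * (d * H * Λ) + Real.log (1/δ) := by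
    have h1 : 8 * H / δ = 2 ^ 3 * H * (1 / δ) := by ring
    rw [h1, Real.log_mul (by positivity) (by positivity), Real.log_mul (by positivity) (by positivity),
      Real.log_pow]
    push_cast
    linarith
  have hpos : 0 < (H : ℝ) ^ 2 / ε ^ 2 * (d * H * Λ + Real.log (1 / δ)) := by positivity
  refine ⟨by linarith, ?_⟩
  have h1 : 2 * d * Real.log (6 * (2 * H * ((2 * Δ ^ H : ℕ) : ℝ) + 1) * d) ≤ 16 * (d * H * Λ) := by
    have := mul_le_mul_of_nonneg_left hlogB (show 0 ≤ 2 * (d:ℝ) by positivity)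
    linarith
  have h2 : 20 * (d * H * Λ + Real.log (1 / δ)) ≤ m * (ε / 2 / H) ^ 2 / 1152 := by
    have h3 := mul_le_mul_of_nonneg_right hm (show 0 ≤ (ε / 2 / H) ^ 2 / 1152 by positivity)
    have h4 : 92160 * ((H : ℝ) ^ 2 / ε ^ 2 * (d * H * Λ + Real.log (1 / δ))) * ((ε / 2 / H) ^ 2 / 1152)
        = 20 * (d * H * Λ + Real.log (1 / δ)) := by
      field_simp
      ring
    rw [h4] at h3
    linarith
  linarith

end GDPW

/-- Uniform convergence for tuning the initialization vector `x ∈ ℝ^d` of gradient descent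
(with fixed step size `η`) over piecewise-polynomial instances, with sample complexity
`m = O((H²/ε²)(dH log(2pdΔ) + log(1/δ)))`. -/
theorem gd_pwpoly_init_uniform_convergence :
    ∃ C : ℝ, 0 < C ∧
      ∀ (d H p Δ : ℕ), 1 ≤ d → 1 ≤ H → 1 ≤ p → 1 ≤ Δ →
      ∀ θ : ℝ, 0 < θ →
      ∀ η : ℝ, 0 ≤ η →
      ∀ (Ω : Type) (_ : MeasurableSpace Ω)
        (inst : Ω → (EuclideanSpace ℝ (Fin d) → ℝ)),
        (∀ z : Ω, ∃ g : Fin p → MvPolynomial (Fin d) ℝ,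
          IsPWPolyWith p Δ (inst z) g ∧
          ∀ x : EuclideanSpace ℝ (Fin d), ∀ i ≤ H, ∀ k,
            MvPolynomial.eval (fun j => gdIter (inst z) x η i j) (g k) ≠ 0) →
        (∀ x : EuclideanSpace ℝ (Fin d),
          Measurable fun z : Ω => (gdCost H θ (inst z) x η : ℝ)) →
      ∀ (D : Measure Ω), IsProbabilityMeasure D →
      ∀ ε δ : ℝ, 0 < ε → 0 < δ → δ < 1 →
        (∀ (m : ℕ) (t : ℝ), MeasurableSet
          {s : Fin m → Ω | ∀ x : EuclideanSpace ℝ (Fin d),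
            |(∑ j : Fin m, (gdCost H θ (inst (s j)) x η : ℝ)) / m
              - ∫ z, (gdCost H θ (inst z) x η : ℝ) ∂D| ≤ t}) →
      ∀ m : ℕ,
        C * ((H : ℝ) ^ 2 / ε ^ 2 *
            ((d : ℝ) * (H : ℝ) * Real.log (2 * p * d * Δ) + Real.log (1 / δ))) ≤ m →
        ENNReal.ofReal (1 - δ) ≤
          (Measure.pi fun _ : Fin m => D)
            {s : Fin m → Ω | ∀ x : EuclideanSpace ℝ (Fin d),
              |(∑ j : Fin m, (gdCost H θ (inst (s j)) x η : ℝ)) / m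
                - ∫ z, (gdCost H θ (inst z) x η : ℝ) ∂D| ≤ ε} := by
  refine ⟨92160, by norm_num, ?_⟩
  intro d H p Δ hd hH hp hΔ θ hθ η _ Ω _ inst hinst hmeas D hD ε δ hε hδ hδ1 hbad m hm
  have hpoly : ∀ z, ∃ q : MvPolynomial (Fin d) ℝ, q.totalDegree ≤ Δ ∧
      inst z = fun w => MvPolynomial.eval (fun j => w j) q := by
    intro z
    obtain ⟨g, hg, hne⟩ := hinst z
    exact GDPW.global_poly _ g hg fun x k => hne x 0 (Nat.zero_le _) k
  choose q hq hqe using hpoly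
  obtain ⟨hm0, hE⟩ := GDPW.numeric hd hH hp hΔ hε hδ hδ1 hm
  have hmpos : 0 < m := by exact_mod_cast hm0
  let u : (Fin d → ℝ) → Ω → ℕ := fun x z => gdCost H θ (inst z) (WithLp.toLp 2 x) η
  let h : Ω → Fin H → MvPolynomial (Fin d) ℝ := fun z j => GDPW.hp θ η (q z) j
  have hdeg : ∀ z j, (h z j).totalDegree ≤ 2 * Δ ^ H := fun z j =>
    GDPW.hp_degree hΔ θ η (q z) (hq z) j H j.2
  have hu : ∀ x z, u x z ≤ H := fun x z => GDPW.gdCost_le _ _ _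
  have hsig : ∀ x y z, (∀ j, 0 ≤ MvPolynomial.eval x (h z j) ↔ 0 ≤ MvPolynomial.eval y (h z j)) →
      u x z = u y z := by
    intro x y z hxy
    simp only [u, hqe z]
    exact GDPW.gdCost_sign hθ η (q z) (WithLp.toLp 2 x) (WithLp.toLp 2 y) hxy
  have hcompl : ∀ n t, GDPW.badSet D u Set.univ n t = {s : Fin n → Ω | ∀ x : EuclideanSpace ℝ (Fin d),
            |(∑ j : Fin n, (gdCost H θ (inst (s j)) x η : ℝ)) / n
              - ∫ z, (gdCost H θ (inst z) x η : ℝ) ∂D| ≤ t}ᶜ := by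
    intro n t
    ext s
    simp only [GDPW.badSet, Set.mem_univ, true_and, Set.mem_ofPred_eq, Set.mem_compl_iff, not_forall,
      not_le, u]
    constructor
    · rintro ⟨x, hx⟩; exact ⟨WithLp.toLp 2 x, hx⟩
    · rintro ⟨x, hx⟩; exact ⟨WithLp.ofLp x, hx⟩
  have hbm : ∀ n t, MeasurableSet (GDPW.badSet D u Set.univ n t) := by
    intro n t
    rw [hcompl]
    exact (hbad n t).compl
  have hB1 : (1:ℝ) ≤ 2 * H * ((2 * Δ ^ H : ℕ) : ℝ) + 1 := by
    have : (0:ℝ) ≤ 2 * H * ((2 * Δ ^ H : ℕ) : ℝ) := by positivity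
    linarith
  have hmain := GDPW.vc_prob D hmpos hd hH hB1 hε hδ hδ1.le u hu
    (fun i k hk ψ => GDPW.growth hd h hdeg u hsig i k hk ψ) hE Set.univ hbm
    (GDPW.gc D hd hH h hdeg u hu (fun x => hmeas _) hsig hbm (half_pos hε))
  rw [hcompl, probReal_compl_eq_one_sub (hbad m ε)] at hmain
  refine ENNReal.ofReal_le_of_le_toReal ?_
  change _ ≤ (Measure.pi fun _ : Fin m => D).real _
  linarith
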